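/- arXiv:1306.3969 — 3 statements merged into one kernel-verified Lean document; each statement's English description precedes it below -/
import Mathlib

section
/- Suppose A_1,...,A_m are Hermitian positive semidefinite n×n matrices satisfying ∑_{i=1}^m A_i = I and tr(A_i) ≤ ε for all i. Then every real root of the mixed characteristic polynomial μ[A_1,...,A_m](x) = (∏_{i=1}^m (1-∂_{z_i})) det(xI + ∑_i z_i A_i)|_{z=0} is at most (1+√ε)². -/
open ComplexOrder

open MvPolynomial

/-- Successively apply the operators (1 - ∂_{z_0}), ..., (1 - ∂_{z_{k-1}}). -/
noncomputable def applyOps {m : ℕ} (p : MvPolynomial (Fin m) ℂ) : ℕ → MvPolynomial (Fin m) ℂ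
  | 0 => p
  | k + 1 => if h : k < m then applyOps p k - pderiv (⟨k, h⟩ : Fin m) (applyOps p k)
             else applyOps p k

open Filter Topology

/-- A monomial `κ u ^ k`, `k ≥ 1`, maps the upper half plane to the closed lower half plane
only if `κ` is a nonpositive real number; for `k ≥ 2` this forces `κ = 0`. -/
lemma im_eq_zero_and_re_nonpos_of_im_mul_pow_nonpos {κ : ℂ} {k : ℕ} (hk : k ≠ 0)
    (h : ∀ u : ℂ, 0 < u.im → (κ * u ^ k).im ≤ 0) :
    κ.im = 0 ∧ κ.re ≤ 0 ∧ (2 ≤ k → κ = 0) := by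
  have hclosed : ∀ u : ℂ, 0 ≤ u.im → (κ * u ^ k).im ≤ 0 := by
    intro u hu
    have hc : Continuous fun η : ℝ => (κ * (u + η * Complex.I) ^ k).im := by fun_prop
    have ht : Tendsto (fun η : ℝ => (κ * (u + η * Complex.I) ^ k).im) (𝓝[>] 0)
        (𝓝 (κ * u ^ k).im) := by
      have := (hc.tendsto 0).mono_left (nhdsWithin_le_nhds (s := Set.Ioi 0))
      simpa using this
    refine le_of_tendsto ht ?_
    filter_upwards [self_mem_nhdsWithin] with η hη
    apply h
    have : (0 : ℝ) < η := hη
    simp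
    linarith
  have hrot : ∀ φ : ℝ, 0 ≤ φ → φ ≤ k * Real.pi →
      κ.re * Real.sin φ + κ.im * Real.cos φ ≤ 0 := by
    intro φ h0 h1
    have hk' : (0 : ℝ) < k := by positivity
    have key := hclosed (Complex.exp ((φ / k : ℝ) * Complex.I)) (by
      rw [Complex.exp_ofReal_mul_I_im]
      apply Real.sin_nonneg_of_nonneg_of_le_pi (by positivity)
      rw [div_le_iff₀ hk']
      linarith)
    rw [← Complex.exp_nat_mul] at key
    have e : (k : ℂ) * ((φ / k : ℝ) * Complex.I) = φ * Complex.I := by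
      have : (k : ℂ) ≠ 0 := by exact_mod_cast hk
      push_cast
      field_simp
    rw [e, Complex.mul_im, Complex.exp_ofReal_mul_I_im, Complex.exp_ofReal_mul_I_re] at key
    exact key
  have hpi := Real.pi_pos
  have hk1 : (1 : ℝ) ≤ k := by exact_mod_cast Nat.one_le_iff_ne_zero.mpr hk
  have h0 := hrot 0 le_rfl (by positivity)
  have h1 := hrot Real.pi hpi.le (by nlinarith)
  have h2 := hrot (Real.pi / 2) (by positivity) (by nlinarith)
  simp at h0 h1 h2
  have him : κ.im = 0 := le_antisymm h0 h1
  refine ⟨him, h2, fun hk2 => ?_⟩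
  have hk2' : (2 : ℝ) ≤ k := by exact_mod_cast hk2
  have h3 := hrot (Real.pi / 2 + Real.pi) (by positivity) (by nlinarith)
  rw [Real.sin_add_pi] at h3
  simp [him] at h3
  exact Complex.ext (le_antisymm h2 h3) him

/-- Poles on the real axis of a function with values in the closed lower half plane are simple
with nonnegative residue. -/
lemma residue_nonneg_of_im_nonpos {f : ℂ → ℂ} {r : ℂ} (hr : r.im = 0) (hf : ContinuousAt f r)
    {k : ℕ} (hk : k ≠ 0) (h : ∀ w : ℂ, 0 < w.im → (f w / (w - r) ^ k).im ≤ 0) :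
    (2 ≤ k → f r = 0) ∧ (k = 1 → (f r).im = 0 ∧ 0 ≤ (f r).re) := by
  have key := im_eq_zero_and_re_nonpos_of_im_mul_pow_nonpos (κ := (-1) ^ k * f r) hk (by
    intro u hu
    have hu0 : u ≠ 0 := by
      rintro rfl
      simp at hu
    have hv : 0 < (-u⁻¹).im := by
      have := Complex.normSq_pos.mpr hu0
      simp only [Complex.neg_im, Complex.inv_im]
      rw [neg_div, neg_neg]
      positivity
    have hcont : Tendsto (fun t : ℝ => (f (r + t * (-u⁻¹)) * (-u) ^ k).im) (𝓝[>] 0)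
        (𝓝 (f r * (-u) ^ k).im) := by
      have h1 : Tendsto (fun t : ℝ => r + t * (-u⁻¹)) (𝓝[>] 0) (𝓝 r) := by
        have hc : Continuous fun t : ℝ => r + t * (-u⁻¹) := by fun_prop
        simpa using (hc.tendsto 0).mono_left (nhdsWithin_le_nhds (s := Set.Ioi 0))
      exact (Complex.continuous_im.tendsto _).comp
        ((hf.tendsto.comp h1).mul tendsto_const_nhds)
    have hle : (f r * (-u) ^ k).im ≤ 0 := by
      refine le_of_tendsto hcont ?_
      filter_upwards [self_mem_nhdsWithin] with t ht
      have ht : (0 : ℝ) < t := ht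
      have hw := h (r + t * (-u⁻¹)) (by
        rw [Complex.add_im, hr, Complex.im_ofReal_mul, zero_add]
        positivity)
      have e : f (r + t * (-u⁻¹)) / (r + t * (-u⁻¹) - r) ^ k =
          ((t ^ k)⁻¹ : ℝ) * (f (r + t * (-u⁻¹)) * (-u) ^ k) := by
        have ht' : (t : ℂ) ≠ 0 := by exact_mod_cast ht.ne'
        rw [add_sub_cancel_left, div_eq_mul_inv, ← inv_pow, mul_inv, ← neg_inv, inv_inv, mul_pow]
        push_cast
        rw [inv_pow]
        ring
      rw [e, Complex.im_ofReal_mul] at hw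
      exact nonpos_of_mul_nonpos_right hw (by positivity)
    rwa [mul_right_comm, ← neg_pow, mul_comm])
  refine ⟨fun hk2 => ?_, fun hk1 => ?_⟩
  · have := key.2.2 hk2
    simpa using this
  · subst hk1
    simpa using And.intro key.1 key.2.1

/-- Growth at infinity of a polynomial plus a proper partial fraction with values in the closed
lower half plane. -/
lemma leadingCoeff_of_im_add_sum_nonpos {q : Polynomial ℂ} {s : Finset ℂ} {a : ℂ → ℂ}
    (hs : ∀ r ∈ s, r.im = 0) (hk : q.natDegree ≠ 0)
    (h : ∀ w : ℂ, 0 < w.im → (q.eval w + ∑ r ∈ s, a r / (w - r)).im ≤ 0) :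
    q.natDegree = 1 ∧ q.leadingCoeff.im = 0 ∧ q.leadingCoeff.re ≤ 0 := by
  have key := im_eq_zero_and_re_nonpos_of_im_mul_pow_nonpos (κ := q.leadingCoeff) hk (by
    intro u hu
    have hu0 : u ≠ 0 := by
      rintro rfl
      simp at hu
    let F : ℝ → ℂ := fun τ => ∑ i ∈ Finset.range (q.natDegree + 1),
      q.coeff i * u ^ i * (τ : ℂ) ^ (q.natDegree - i) +
      ∑ r ∈ s, a r * (τ : ℂ) ^ (q.natDegree + 1) / (u - r * τ)
    have hF : ContinuousAt F 0 := by
      refine ContinuousAt.add (by fun_prop) (tendsto_finsetSum _ fun r _ => ?_)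
      refine ContinuousAt.div (by fun_prop) (by fun_prop) (by simpa using hu0)
    have hF0 : F 0 = q.leadingCoeff * u ^ q.natDegree := by
      simp only [F]
      rw [Finset.sum_range_succ, Finset.sum_eq_zero, Finset.sum_eq_zero]
      · simp
      · intro r _
        simp
      · intro i hi
        have : q.natDegree - i ≠ 0 := by
          have := Finset.mem_range.mp hi
          omega
        simp [this]
    rw [← hF0]
    have ht : Tendsto (fun τ => (F τ).im) (𝓝[>] 0) (𝓝 (F 0).im) :=
      ((Complex.continuous_im.tendsto _).comp hF.tendsto).mono_left nhdsWithin_le_nhds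
    refine le_of_tendsto ht ?_
    filter_upwards [self_mem_nhdsWithin] with τ hτ
    have hτ : (0 : ℝ) < τ := hτ
    have hτ' : (τ : ℂ) ≠ 0 := by exact_mod_cast hτ.ne'
    have hwim : 0 < ((τ⁻¹ : ℝ) * u : ℂ).im := by
      rw [Complex.im_ofReal_mul]
      positivity
    have hw := h _ hwim
    have e : F τ = ((τ ^ q.natDegree : ℝ) : ℂ) * (q.eval ((τ⁻¹ : ℝ) * u : ℂ) +
        ∑ r ∈ s, a r / ((τ⁻¹ : ℝ) * u - r)) := by
      rw [mul_add, Polynomial.eval_eq_sum_range, Finset.mul_sum, Finset.mul_sum]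
      simp only [F]
      congr 1
      · refine Finset.sum_congr rfl fun i hi => ?_
        have : q.natDegree = (q.natDegree - i) + i := by
          have := Finset.mem_range.mp hi
          omega
        push_cast
        rw [mul_pow, inv_pow]
        nth_rewrite 2 [this]
        rw [pow_add]
        field_simp
      · refine Finset.sum_congr rfl fun r hr => ?_
        have hne : (u - r * τ : ℂ) ≠ 0 := by
          intro h0
          have := congrArg Complex.im h0
          simp [hs r hr] at this
          exact hu.ne' this
        have e2 : ((τ⁻¹ : ℝ) * u - r : ℂ) = (u - r * τ) / τ := by
          push_cast
          field_simp
        rw [e2]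
        push_cast
        field_simp
        ring
    rw [e, Complex.im_ofReal_mul]
    exact mul_nonpos_of_nonneg_of_nonpos (by positivity) hw)
  refine ⟨?_, key.1, key.2.1⟩
  by_contra h1
  have h0 := key.2.2 (by omega)
  rw [Polynomial.leadingCoeff_eq_zero] at h0
  simp [h0] at hk

/-- Partial fractions of a rational function without poles off the real axis that maps the upper
half plane to the closed lower half plane, in the coprime case. -/
lemma exists_partial_fraction_of_isCoprime {D N : Polynomial ℂ} (hcop : IsCoprime D N)
    (hD : ∀ w : ℂ, w.im ≠ 0 → D.eval w ≠ 0)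
    (h : ∀ w : ℂ, 0 < w.im → (N.eval w / D.eval w).im ≤ 0) :
    ∃ (c : ℂ) (b : ℝ) (s : Finset ℂ) (a : ℂ → ℝ), b ≤ 0 ∧
      (∀ r ∈ s, 0 ≤ a r ∧ D.eval r = 0) ∧
      ∀ w, D.eval w ≠ 0 → N.eval w / D.eval w = c + b * w + ∑ r ∈ s, a r / (w - r) := by
  classical
  have hD0 : D ≠ 0 := by
    rintro rfl
    exact hD Complex.I (by simp) (by simp)
  have hreal : ∀ r, D.eval r = 0 → r.im = 0 := fun r hr => by
    by_contra h'
    exact hD r h' hr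
  have hroots : ∀ r, D.eval r = 0 → D.rootMultiplicity r = 1 := by
    intro r hr
    obtain ⟨D₁, hD₁, hnd⟩ := Polynomial.exists_eq_pow_rootMultiplicity_mul_and_not_dvd D hD0 r
    have hD₁r : D₁.eval r ≠ 0 := by
      rwa [Polynomial.dvd_iff_isRoot] at hnd
    have hNr : N.eval r ≠ 0 := by
      intro hN
      obtain ⟨x, y, hxy⟩ := hcop
      have := congrArg (Polynomial.eval r) hxy
      simp [hN, hr] at this
    have hk : D.rootMultiplicity r ≠ 0 :=
      ((Polynomial.rootMultiplicity_pos hD0).mpr hr).ne'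
    have key := residue_nonneg_of_im_nonpos (f := fun w => N.eval w / D₁.eval w)
      (hreal r hr) (ContinuousAt.div N.continuousAt D₁.continuousAt hD₁r) hk (by
        intro w hw
        have := h w hw
        rw [hD₁] at this
        simp only [Polynomial.eval_mul, Polynomial.eval_pow, Polynomial.eval_sub,
          Polynomial.eval_X, Polynomial.eval_C] at this
        rwa [div_div, mul_comm])
    by_contra h1
    exact div_ne_zero hNr hD₁r (key.1 (by omega))
  set s := D.roots.toFinset with hs
  have hmem : ∀ r, r ∈ s ↔ D.eval r = 0 := by
    intro r
    simp [hs, hD0]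
  have hnodup : D.roots.Nodup := by
    rw [Multiset.nodup_iff_count_le_one]
    intro r
    rw [Polynomial.count_roots]
    by_cases hr : D.eval r = 0
    · exact (hroots r hr).le
    · rw [Polynomial.rootMultiplicity_eq_zero hr]
      exact zero_le_one
  have hsplit := IsAlgClosed.splits D
  have hcard : D.degree = s.card := by
    rw [hs, Multiset.toFinset_card_of_nodup hnodup, Polynomial.degree_eq_natDegree hD0,
      hsplit.natDegree_eq_card_roots]
  have hnodal : ∀ w, D.eval w = D.leadingCoeff * (Lagrange.nodal s id).eval w := by
    intro w
    rw [hsplit.eval_eq_prod_roots, Lagrange.eval_nodal, Finset.prod, hs,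
      Multiset.toFinset_val, hnodup.dedup]
    rfl
  set q := N / D
  set R := N % D
  set α : ℂ → ℂ := fun r => Lagrange.nodalWeight s id r * R.eval r / D.leadingCoeff with hα
  have hR : R = Lagrange.interpolate s id fun i => R.eval (id i) :=
    Lagrange.eq_interpolate (Set.injOn_id _) (by
      rw [← hcard]
      exact Polynomial.degree_mod_lt _ hD0)
  have hrep : ∀ w, D.eval w ≠ 0 →
      N.eval w / D.eval w = q.eval w + ∑ r ∈ s, α r / (w - r) := by
    intro w hw
    have hN : N.eval w = D.eval w * q.eval w + R.eval w := by
      rw [← Polynomial.eval_mul, ← Polynomial.eval_add, EuclideanDomain.div_add_mod]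
    have hRw : R.eval w = (Lagrange.nodal s id).eval w *
        ∑ i ∈ s, Lagrange.nodalWeight s id i * (w - id i)⁻¹ * R.eval (id i) := by
      conv_lhs => rw [hR]
      exact Lagrange.eval_interpolate_not_at_node _ (by
        rintro i hi rfl
        exact hw ((hmem _).mp hi))
    have hn : (Lagrange.nodal s id).eval w ≠ 0 := by
      intro h0
      rw [hnodal, h0, mul_zero] at hw
      exact hw rfl
    have hl : D.leadingCoeff ≠ 0 := by simpa using hD0
    rw [hN, add_div, mul_div_cancel_left₀ _ hw, hRw, hnodal w, mul_comm D.leadingCoeff,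
      mul_div_mul_left _ _ hn, Finset.sum_div]
    congr 1
    refine Finset.sum_congr rfl fun r _ => ?_
    simp only [hα, id, div_eq_mul_inv]
    ring
  have hα' : ∀ r ∈ s, (α r).im = 0 ∧ 0 ≤ (α r).re := by
    intro r hr
    have hr0 := (hmem r).mp hr
    have key := residue_nonneg_of_im_nonpos
      (f := fun w => (w - r) * (q.eval w + ∑ r' ∈ s.erase r, α r' / (w - r')) + α r)
      (hreal r hr0) (by
        refine ContinuousAt.add (ContinuousAt.mul (by fun_prop) (ContinuousAt.add
          q.continuousAt (tendsto_finsetSum _ fun r' hr' => ?_))) continuousAt_const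
        exact ContinuousAt.div (by fun_prop) (by fun_prop)
          (sub_ne_zero.mpr (Finset.ne_of_mem_erase hr').symm)) one_ne_zero (by
        intro w hw
        have hDw := hD w hw.ne'
        have hwr : w - r ≠ 0 := by
          intro h0
          rw [sub_eq_zero.mp h0] at hDw
          exact hDw hr0
        have := h w hw
        rw [hrep w hDw, ← Finset.add_sum_erase s _ hr] at this
        convert this using 2
        field_simp
        ring)
    simpa using key.2 rfl
  have hαre : ∀ r ∈ s, α r = ((α r).re : ℂ) := fun r hr =>
    Complex.ext rfl (by simp [(hα' r hr).1])
  have hq : ∃ (c : ℂ) (b : ℝ), b ≤ 0 ∧ ∀ w, q.eval w = c + b * w := by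
    by_cases hk : q.natDegree = 0
    · refine ⟨q.coeff 0, 0, le_rfl, fun w => ?_⟩
      rw [Polynomial.eq_C_of_natDegree_eq_zero hk]
      simp
    · obtain ⟨h1, h2, h3⟩ := leadingCoeff_of_im_add_sum_nonpos (a := α)
        (fun r hr => hreal r ((hmem r).mp hr)) hk (fun w hw => by
          rw [← hrep w (hD w hw.ne')]
          exact h w hw)
      refine ⟨q.coeff 0, q.leadingCoeff.re, h3, fun w => ?_⟩
      have e : ((q.leadingCoeff.re : ℝ) : ℂ) = q.coeff 1 := by
        rw [Polynomial.leadingCoeff, h1] at h2 ⊢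
        exact Complex.ext rfl (by simp [h2])
      rw [e, Polynomial.eval_eq_sum_range, h1]
      simp [Finset.sum_range_succ]
  obtain ⟨c, b, hb, hq⟩ := hq
  refine ⟨c, b, s, fun r => (α r).re, hb, fun r hr => ⟨(hα' r hr).2, (hmem r).mp hr⟩, ?_⟩
  intro w hw
  rw [hrep w hw, hq]
  congr 1
  exact Finset.sum_congr rfl fun r hr => by rw [← hαre r hr]

/-- Partial fractions of a rational function without poles off the real axis that maps the upper
half plane to the closed lower half plane. -/
lemma exists_partial_fraction {D N : Polynomial ℂ}
    (hD : ∀ w : ℂ, w.im ≠ 0 → D.eval w ≠ 0)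
    (h : ∀ w : ℂ, 0 < w.im → (N.eval w / D.eval w).im ≤ 0) :
    ∃ (c : ℂ) (b : ℝ) (s : Finset ℂ) (a : ℂ → ℝ), b ≤ 0 ∧
      (∀ r ∈ s, 0 ≤ a r ∧ D.eval r = 0) ∧
      ∀ w, D.eval w ≠ 0 → N.eval w / D.eval w = c + b * w + ∑ r ∈ s, a r / (w - r) := by
  classical
  have hD0 : D ≠ 0 := by
    rintro rfl
    exact hD Complex.I (by simp) (by simp)
  set G := EuclideanDomain.gcd D N
  have hG0 : G ≠ 0 := fun h0 => hD0 (EuclideanDomain.gcd_eq_zero_iff.mp h0).1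
  obtain ⟨D', hD'⟩ := EuclideanDomain.gcd_dvd_left D N
  obtain ⟨N', hN'⟩ := EuclideanDomain.gcd_dvd_right D N
  have hcop : IsCoprime D' N' := by
    refine ⟨EuclideanDomain.gcdA D N, EuclideanDomain.gcdB D N, mul_left_cancel₀ hG0 ?_⟩
    have e := EuclideanDomain.gcd_eq_gcd_ab D N
    change G = _ at e
    change D = G * D' at hD'
    change N = G * N' at hN'
    linear_combination -EuclideanDomain.gcdA D N * hD' - EuclideanDomain.gcdB D N * hN' - e
  have hDeval : ∀ w, D.eval w = G.eval w * D'.eval w := fun w => by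
    rw [← Polynomial.eval_mul, ← hD']
  have hNeval : ∀ w, N.eval w = G.eval w * N'.eval w := fun w => by
    rw [← Polynomial.eval_mul, ← hN']
  have hquot : ∀ w, D.eval w ≠ 0 → N.eval w / D.eval w = N'.eval w / D'.eval w := fun w hw => by
    rw [hDeval] at hw
    rw [hDeval, hNeval, mul_div_mul_left _ _ (left_ne_zero_of_mul hw)]
  obtain ⟨c, b, s, a, hb, hs, hrep⟩ := exists_partial_fraction_of_isCoprime hcop
    (fun w hw => right_ne_zero_of_mul ((hDeval w) ▸ hD w hw))
    (fun w hw => hquot w (hD w hw.ne') ▸ h w hw)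
  refine ⟨c, b, s, a, hb, fun r hr => ⟨(hs r hr).1, by rw [hDeval, (hs r hr).2, mul_zero]⟩, ?_⟩
  intro w hw
  rw [hquot w hw, hrep w (right_ne_zero_of_mul ((hDeval w) ▸ hw))]

/-- A rational function that maps the upper half plane to the closed lower half plane and has all
its poles on the negative real axis is nonincreasing and convex on the nonnegative real axis. -/
lemma decreasing_and_convex_of_im_nonpos {D N : Polynomial ℂ}
    (hD : ∀ w : ℂ, w.im ≠ 0 → D.eval w ≠ 0) (hDpos : ∀ t : ℝ, 0 ≤ t → D.eval (t : ℂ) ≠ 0)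
    (h : ∀ w : ℂ, 0 < w.im → (N.eval w / D.eval w).im ≤ 0) {t : ℝ} (ht : 0 ≤ t) :
    ∃ d : ℝ, d ≤ 0 ∧
      (N.derivative.eval (t : ℂ) * D.eval (t : ℂ) - N.eval (t : ℂ) * D.derivative.eval (t : ℂ)) /
        D.eval (t : ℂ) ^ 2 = d ∧
      (N.eval (t : ℂ) / D.eval (t : ℂ)).re ≤ (N.eval 0 / D.eval 0).re + t * d := by
  obtain ⟨c, b, s, a, hb, hs, hrep⟩ := exists_partial_fraction hD h
  have hsreal : ∀ r ∈ s, r = ((r.re : ℝ) : ℂ) := fun r hr => by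
    refine Complex.ext rfl ?_
    by_contra h'
    exact hD r (by simpa using h') (hs r hr).2
  have hsneg : ∀ r ∈ s, r.re < 0 := fun r hr => by
    by_contra! h'
    exact hDpos _ h' (hsreal r hr ▸ (hs r hr).2)
  have hDt := hDpos t ht
  have hsum : ∀ u : ℝ, 0 ≤ u → N.eval (u : ℂ) / D.eval (u : ℂ) =
      c + ((b * u + ∑ r ∈ s, a r / (u - r.re) : ℝ) : ℂ) := by
    intro u hu
    rw [hrep _ (hDpos u hu), add_assoc]
    push_cast
    congr 2
    exact Finset.sum_congr rfl fun r hr => by rw [← hsreal r hr]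
  refine ⟨b - ∑ r ∈ s, a r / (t - r.re) ^ 2, ?_, ?_, ?_⟩
  · have : 0 ≤ ∑ r ∈ s, a r / (t - r.re) ^ 2 :=
      Finset.sum_nonneg fun r hr => div_nonneg (hs r hr).1 (sq_nonneg _)
    linarith
  · have h1 : HasDerivAt (fun w => N.eval w / D.eval w) _ (t : ℂ) :=
      (N.hasDerivAt (t : ℂ)).div (D.hasDerivAt (t : ℂ)) hDt
    have h2 : HasDerivAt (fun w : ℂ => c + b * w + ∑ r ∈ s, a r / (w - r))
        (b + ∑ r ∈ s, -(a r : ℂ) / ((t : ℂ) - r) ^ 2) (t : ℂ) := by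
      refine HasDerivAt.add ?_ (HasDerivAt.fun_sum fun r hr => ?_)
      · simpa using ((hasDerivAt_id (t : ℂ)).const_mul (b : ℂ)).const_add c
      · have hne : (t : ℂ) - r ≠ 0 := by
          rw [hsreal r hr, ← Complex.ofReal_sub, Complex.ofReal_ne_zero]
          have := hsneg r hr
          linarith
        simpa using (hasDerivAt_const (t : ℂ) (a r : ℂ)).fun_div
          ((hasDerivAt_id (t : ℂ)).sub_const r) hne
    have hev : (fun w => N.eval w / D.eval w) =ᶠ[𝓝 (t : ℂ)]
        fun w : ℂ => c + b * w + ∑ r ∈ s, a r / (w - r) := by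
      filter_upwards [D.continuous.continuousAt.eventually_ne hDt] with w hw using hrep w hw
    rw [h1.unique (h2.congr_of_eventuallyEq hev)]
    push_cast
    rw [sub_eq_add_neg, ← Finset.sum_neg_distrib]
    congr 1
    exact Finset.sum_congr rfl fun r hr => by rw [← hsreal r hr, neg_div]
  · have h0 := hsum 0 le_rfl
    rw [Complex.ofReal_zero] at h0
    rw [hsum t ht, h0, Complex.add_re, Complex.add_re, Complex.ofReal_re, Complex.ofReal_re,
      mul_sub, Finset.mul_sum]
    have : ∑ r ∈ s, a r / (t - r.re) + ∑ r ∈ s, t * (a r / (t - r.re) ^ 2) ≤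
        ∑ r ∈ s, a r / (0 - r.re) := by
      rw [← Finset.sum_add_distrib]
      refine Finset.sum_le_sum fun r hr => ?_
      have har := (hs r hr).1
      have hr' := hsneg r hr
      obtain ⟨ρ, hρ⟩ : ∃ ρ, ρ = -r.re := ⟨_, rfl⟩
      have hρ0 : 0 < ρ := by linarith
      rw [zero_sub, ← hρ, show t - r.re = t + ρ by rw [hρ]; ring, ← sub_nonneg]
      have e : a r / ρ - (a r / (t + ρ) + t * (a r / (t + ρ) ^ 2)) =
          a r * t ^ 2 / (ρ * (t + ρ) ^ 2) := by
        field_simp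
        ring
      rw [e]
      positivity
    linarith

/-- The restriction of `p` to the line through `a` with direction `v`. -/
noncomputable def lineRestrict {ι : Type*} (p : MvPolynomial ι ℂ) (a v : ι → ℂ) : Polynomial ℂ :=
  aeval (fun k => Polynomial.C (a k) + Polynomial.C (v k) * Polynomial.X) p

lemma eval_lineRestrict {ι : Type*} (p : MvPolynomial ι ℂ) (a v : ι → ℂ) (w : ℂ) :
    (lineRestrict p a v).eval w = eval (fun k => a k + v k * w) p := by
  induction p using MvPolynomial.induction_on with
  | C c => simp [lineRestrict]
  | add p q hp hq => simp_all [lineRestrict]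
  | mul_X p k hp => simp_all [lineRestrict]

lemma derivative_lineRestrict_single {ι : Type*} [DecidableEq ι] (p : MvPolynomial ι ℂ)
    (a : ι → ℂ) (i : ι) :
    (lineRestrict p a (Pi.single i 1)).derivative =
      lineRestrict (pderiv i p) a (Pi.single i 1) := by
  induction p using MvPolynomial.induction_on with
  | C c => simp [lineRestrict]
  | add p q hp hq => simp_all [lineRestrict]
  | mul_X p k hp =>
    simp only [lineRestrict] at hp ⊢
    rw [map_mul, Polynomial.derivative_mul, hp, Derivation.leibniz]
    by_cases hk : k = i
    · subst hk
      simp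
      ring
    · simp [hk]
      ring

lemma natDegree_lineRestrict_le {ι : Type*} (p : MvPolynomial ι ℂ) (a v : ι → ℂ) :
    (lineRestrict p a v).natDegree ≤ p.totalDegree := by
  have := MvPolynomial.aeval_natDegree_le p le_rfl
    (fun k => Polynomial.C (a k) + Polynomial.C (v k) * Polynomial.X) (n := 1) (fun k => by
      rw [add_comm]
      exact Polynomial.natDegree_linear_le)
  simpa [lineRestrict] using this

/-- The imaginary part of the logarithmic derivative of a polynomial whose roots lie in a half
plane, at a point of the complementary half plane; here `σ` selects the half plane. -/
lemma logDeriv_im_and_sub_derivative_ne_zero {f : Polynomial ℂ} {σ : ℝ}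
    (h : ∀ t : ℂ, 0 ≤ σ * t.im → f.eval t ≠ 0) :
    σ * (f.derivative.eval 0 / f.eval 0).im ≤ 0 ∧ f.eval 0 - f.derivative.eval 0 ≠ 0 := by
  have h0 := h 0 (by simp)
  have hf : f ≠ 0 := by
    rintro rfl
    simp at h0
  have hsum := (IsAlgClosed.splits f).eval_derivative_div_eval_of_ne_zero h0
  have hroot : ∀ r ∈ f.roots, σ * (1 / (0 - r)).im < 0 := by
    intro r hr
    have hr0 : f.eval r = 0 := (Polynomial.mem_roots hf).mp hr
    have hneg : σ * r.im < 0 := by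
      by_contra! h'
      exact h r h' hr0
    have hrne : r ≠ 0 := by
      rintro rfl
      simp at hneg
    have hpos := Complex.normSq_pos.mpr hrne
    have e : (1 / (0 - r)).im = r.im / Complex.normSq r := by
      simp [Complex.inv_im, neg_div]
    rw [e, ← mul_div_assoc]
    exact div_neg_of_neg_of_pos hneg hpos
  have key : ∀ S : Multiset ℂ, (∀ r ∈ S, σ * (1 / (0 - r)).im < 0) →
      σ * (S.map fun r => 1 / (0 - r)).sum.im ≤ 0 ∧
      (S.map fun r => 1 / (0 - r)).sum ≠ 1 := by
    intro S
    have aux : ∀ S : Multiset ℂ, (∀ r ∈ S, σ * (1 / (0 - r)).im < 0) →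
        σ * (S.map fun r => 1 / (0 - r)).sum.im ≤ 0 := by
      intro S
      induction S using Multiset.induction_on with
      | empty => simp
      | cons r S ih =>
        intro hS
        have h1 := hS r (Multiset.mem_cons_self r S)
        have h2 := ih fun r' hr' => hS r' (Multiset.mem_cons_of_mem hr')
        rw [Multiset.map_cons, Multiset.sum_cons, Complex.add_im, mul_add]
        linarith
    refine fun hS => ⟨aux S hS, ?_⟩
    induction S using Multiset.induction_on with
    | empty => simp
    | cons r S _ =>
      have h1 := hS r (Multiset.mem_cons_self r S)
      have h2 := aux S fun r' hr' => hS r' (Multiset.mem_cons_of_mem hr')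
      intro h3
      have h4 := congrArg (fun z => σ * z.im) h3
      simp only [Multiset.map_cons, Multiset.sum_cons, Complex.add_im, mul_add,
        Complex.one_im, mul_zero] at h4
      linarith
  obtain ⟨h1, h2⟩ := key _ hroot
  rw [← hsum] at h1 h2
  refine ⟨h1, fun h3 => h2 ?_⟩
  rw [← sub_eq_zero.mp h3, div_self h0]

/-- Polynomials without zeros in the product of upper half planes and in the product of lower
half planes. -/
def IsRealStable {ι : Type*} (p : MvPolynomial ι ℂ) : Prop :=
  ∀ σ : ℝ, σ ≠ 0 → ∀ z : ι → ℂ, (∀ i, 0 < σ * (z i).im) → eval z p ≠ 0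

lemma IsRealStable.line {ι : Type*} [DecidableEq ι] {p : MvPolynomial ι ℂ}
    (hp : IsRealStable p) {σ : ℝ} (hσ : σ ≠ 0) {z : ι → ℂ} (hz : ∀ i, 0 < σ * (z i).im) (i : ι)
    (t : ℂ) (ht : 0 ≤ σ * t.im) : (lineRestrict p z (Pi.single i 1)).eval t ≠ 0 := by
  rw [eval_lineRestrict]
  refine hp σ hσ _ fun k => ?_
  have := hz k
  by_cases hk : k = i
  · subst hk
    simp [mul_add]
    linarith
  · simpa [hk] using this

lemma eval_lineRestrict_zero {ι : Type*} (p : MvPolynomial ι ℂ) (a v : ι → ℂ) :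
    (lineRestrict p a v).eval 0 = eval a p := by
  simp [eval_lineRestrict]

lemma IsRealStable.sub_pderiv {ι : Type*} {p : MvPolynomial ι ℂ}
    (hp : IsRealStable p) (i : ι) : IsRealStable (p - pderiv i p) := by
  classical
  intro σ hσ z hz
  have := (logDeriv_im_and_sub_derivative_ne_zero (hp.line hσ hz i)).2
  rwa [derivative_lineRestrict_single, eval_lineRestrict_zero, eval_lineRestrict_zero,
    ← map_sub] at this

lemma IsRealStable.im_pderiv_div {ι : Type*} {p : MvPolynomial ι ℂ}
    (hp : IsRealStable p) (i : ι) {σ : ℝ} (hσ : σ ≠ 0) {z : ι → ℂ} (hz : ∀ i, 0 ≤ σ * (z i).im)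
    (hpz : eval z p ≠ 0) : σ * (eval z (pderiv i p) / eval z p).im ≤ 0 := by
  classical
  let y : ℝ → ι → ℂ := fun η k => z k + σ * η * Complex.I
  have hy : Continuous y := by fun_prop
  have hy0 : y 0 = z := by
    funext k
    simp [y]
  have hcont : ContinuousAt (fun η => σ * (eval (y η) (pderiv i p) / eval (y η) p).im) 0 := by
    refine continuousAt_const.mul (Complex.continuous_im.continuousAt.comp (ContinuousAt.div
      ((MvPolynomial.continuous_eval _).comp hy).continuousAt
      ((MvPolynomial.continuous_eval _).comp hy).continuousAt ?_))
    rwa [hy0]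
  have ht := hcont.tendsto.mono_left (nhdsWithin_le_nhds (s := Set.Ioi 0))
  rw [hy0] at ht
  refine le_of_tendsto ht ?_
  filter_upwards [self_mem_nhdsWithin] with η hη
  have hη : (0 : ℝ) < η := hη
  have := (logDeriv_im_and_sub_derivative_ne_zero (hp.line (z := y η) hσ (fun k => by
    have h1 := hz k
    have h2 : 0 < σ * σ := mul_self_pos.mpr hσ
    simp [y, mul_add]
    nlinarith) i)).1
  rwa [derivative_lineRestrict_single, eval_lineRestrict_zero, eval_lineRestrict_zero] at this

/-- A quantitative form of Hurwitz's theorem: moving away from a half plane containing all roots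
changes the modulus of a polynomial by a controlled factor. -/
lemma norm_eval_zero_le_of_roots {f : Polynomial ℂ} {σ : ℝ} {w : ℂ} (hw : 0 < σ * w.im)
    (h : ∀ t : ℂ, 0 ≤ σ * t.im → f.eval t ≠ 0) :
    ‖f.eval 0‖ ≤ (1 + ‖w‖ / |w.im|) ^ f.natDegree * ‖f.eval w‖ := by
  have hf : f ≠ 0 := by
    rintro rfl
    exact h w hw.le (by simp)
  have hwim : 0 < |w.im| := by
    rw [abs_pos]
    rintro h0
    simp [h0] at hw
  have hsplit := IsAlgClosed.splits f
  have hroot : ∀ r ∈ f.roots, ‖0 - r‖ ≤ (1 + ‖w‖ / |w.im|) * ‖w - r‖ := by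
    intro r hr
    have hneg : σ * r.im < 0 := by
      by_contra! h'
      exact h r h' ((Polynomial.mem_roots hf).mp hr)
    have h1 : |w.im| ≤ ‖w - r‖ := by
      refine le_trans ?_ (Complex.abs_im_le_norm (w - r))
      rw [Complex.sub_im]
      rcases lt_trichotomy σ 0 with hσ | hσ | hσ
      · have a1 : w.im < 0 := by nlinarith
        have a2 : 0 < r.im := by nlinarith
        rw [abs_of_neg a1, abs_of_neg (by linarith)]
        linarith
      · simp [hσ] at hw
      · have a1 : 0 < w.im := by nlinarith
        have a2 : r.im < 0 := by nlinarith
        rw [abs_of_pos a1, abs_of_pos (by linarith)]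
        linarith
    have h2 : ‖w‖ ≤ ‖w‖ / |w.im| * ‖w - r‖ := by
      rw [div_mul_eq_mul_div, le_div_iff₀ hwim]
      gcongr
    calc ‖0 - r‖ = ‖(w - r) - w‖ := by congr 1; ring
      _ ≤ ‖w - r‖ + ‖w‖ := norm_sub_le _ _
      _ ≤ (1 + ‖w‖ / |w.im|) * ‖w - r‖ := by linarith
  have key : ∀ S : Multiset ℂ, (∀ r ∈ S, ‖0 - r‖ ≤ (1 + ‖w‖ / |w.im|) * ‖w - r‖) →
      ‖(S.map fun r => 0 - r).prod‖ ≤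
        (1 + ‖w‖ / |w.im|) ^ S.card * ‖(S.map fun r => w - r).prod‖ := by
    intro S
    induction S using Multiset.induction_on with
    | empty => simp
    | cons r S ih =>
      intro hS
      have h1 := hS r (Multiset.mem_cons_self r S)
      have h2 := ih fun r' hr' => hS r' (Multiset.mem_cons_of_mem hr')
      simp only [Multiset.map_cons, Multiset.prod_cons, Multiset.card_cons, norm_mul]
      calc _ ≤ _ := mul_le_mul h1 h2 (norm_nonneg _) (by positivity)
        _ = _ := by ring
  rw [hsplit.eval_eq_prod_roots 0, hsplit.eval_eq_prod_roots w, hsplit.natDegree_eq_card_roots,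
    norm_mul, norm_mul]
  calc _ ≤ _ := mul_le_mul_of_nonneg_left (key _ hroot) (norm_nonneg _)
    _ = _ := by ring

lemma IsRealStable.eval_line_ne_zero {ι : Type*} {p : MvPolynomial ι ℂ}
    (hp : IsRealStable p) {z v : ι → ℝ} (hv : ∀ i, 0 ≤ v i)
    (hz : eval (fun k => (z k : ℂ)) p ≠ 0) {w : ℂ} (hw : w.im ≠ 0) :
    eval (fun k => (z k : ℂ) + v k * w) p ≠ 0 := by
  set σ := w.im with hσ
  set K := 1 + ‖w‖ / |w.im|
  have hK : 1 ≤ K := by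
    have : 0 ≤ ‖w‖ / |w.im| := by positivity
    simp only [K]
    linarith
  let y : ℝ → ι → ℂ := fun η k => z k + σ * η * Complex.I
  have hy : Continuous y := by fun_prop
  have hbound : ∀ η : ℝ, 0 < η → ‖eval (y η) p‖ ≤
      K ^ p.totalDegree * ‖eval (fun k => y η k + v k * w) p‖ := by
    intro η hη
    have h2 : 0 < σ * σ := mul_self_pos.mpr hw
    have := norm_eval_zero_le_of_roots (f := lineRestrict p (y η) fun k => (v k : ℂ))
      (σ := σ) (w := w) h2 (by
        intro t ht
        rw [eval_lineRestrict]
        refine hp σ hw _ fun k => ?_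
        have h3 := mul_nonneg (hv k) ht
        simp [y, mul_add]
        nlinarith)
    rw [eval_lineRestrict_zero, eval_lineRestrict] at this
    refine this.trans ?_
    gcongr
    exact natDegree_lineRestrict_le _ _ _
  have hlim : ‖eval (y 0) p‖ ≤ K ^ p.totalDegree * ‖eval (fun k => y 0 k + v k * w) p‖ := by
    have c1 : Continuous fun η => ‖eval (y η) p‖ :=
      ((MvPolynomial.continuous_eval p).comp hy).norm
    have c2 : Continuous fun η => K ^ p.totalDegree * ‖eval (fun k => y η k + v k * w) p‖ :=
      continuous_const.mul ((MvPolynomial.continuous_eval p).comp (by fun_prop)).norm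
    refine le_of_tendsto_of_tendsto ((c1.tendsto 0).mono_left
      (nhdsWithin_le_nhds (s := Set.Ioi 0))) ((c2.tendsto 0).mono_left nhdsWithin_le_nhds) ?_
    filter_upwards [self_mem_nhdsWithin] with η hη using hbound η hη
  intro h0
  simp [y, h0] at hlim
  exact hz hlim

/-- The polynomial `p` has no zeros in the closed orthant with apex `z`. -/
def IsAboveRoots {ι : Type*} (p : MvPolynomial ι ℂ) (z : ι → ℝ) : Prop :=
  ∀ y : ι → ℝ, (∀ k, z k ≤ y k) → eval (fun k => (y k : ℂ)) p ≠ 0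

/-- The barrier function `∂ᵢ p / p` at a real point. -/
noncomputable def barrier {ι : Type*} (p : MvPolynomial ι ℂ) (i : ι) (z : ι → ℝ) : ℝ :=
  (eval (fun k => (z k : ℂ)) (pderiv i p) / eval (fun k => (z k : ℂ)) p).re

lemma IsRealStable.ofReal_barrier {ι : Type*} {p : MvPolynomial ι ℂ} (hp : IsRealStable p)
    (i : ι) {z : ι → ℝ} (hz : eval (fun k => (z k : ℂ)) p ≠ 0) :
    eval (fun k => (z k : ℂ)) (pderiv i p) / eval (fun k => (z k : ℂ)) p = barrier p i z := by
  have h1 := hp.im_pderiv_div i (σ := 1) one_ne_zero (by simp) hz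
  have h2 := hp.im_pderiv_div i (σ := -1) (by norm_num) (by simp) hz
  refine Complex.ext rfl ?_
  rw [Complex.ofReal_im]
  linarith

lemma IsRealStable.barrier_line {ι : Type*} {p : MvPolynomial ι ℂ} (hp : IsRealStable p)
    (i : ι) {z v : ι → ℝ} (hz : IsAboveRoots p z) (hv : ∀ k, 0 ≤ v k) {t : ℝ} (ht : 0 ≤ t) :
    ∃ d : ℝ, d ≤ 0 ∧
      ((lineRestrict (pderiv i p) (fun k => (z k : ℂ)) (fun k => (v k : ℂ))).derivative.eval (t : ℂ) *
          (lineRestrict p (fun k => (z k : ℂ)) (fun k => (v k : ℂ))).eval (t : ℂ) -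
        (lineRestrict (pderiv i p) (fun k => (z k : ℂ)) (fun k => (v k : ℂ))).eval (t : ℂ) *
          (lineRestrict p (fun k => (z k : ℂ)) (fun k => (v k : ℂ))).derivative.eval (t : ℂ)) /
        (lineRestrict p (fun k => (z k : ℂ)) (fun k => (v k : ℂ))).eval (t : ℂ) ^ 2 = d ∧
      barrier p i (fun k => z k + v k * t) ≤ barrier p i z + t * d := by
  have hreal : ∀ t : ℝ, 0 ≤ t → eval (fun k => (z k : ℂ) + v k * t) p ≠ 0 := by
    intro t ht
    have := hz (fun k => z k + v k * t) fun k => by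
      have := mul_nonneg (hv k) ht
      linarith
    simpa using this
  have hz0 : eval (fun k => (z k : ℂ)) p ≠ 0 := hz z fun _ => le_rfl
  have hcplx : ∀ w : ℂ, w.im ≠ 0 → eval (fun k => (z k : ℂ) + v k * w) p ≠ 0 := fun w hw =>
    hp.eval_line_ne_zero hv hz0 hw
  obtain ⟨d, hd, hd', hle⟩ := decreasing_and_convex_of_im_nonpos
    (D := lineRestrict p (fun k => (z k : ℂ)) fun k => (v k : ℂ))
    (N := lineRestrict (pderiv i p) (fun k => (z k : ℂ)) fun k => (v k : ℂ))
    (fun w hw => by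
      rw [eval_lineRestrict]
      exact hcplx w hw)
    (fun t ht => by
      rw [eval_lineRestrict]
      exact hreal t ht)
    (fun w hw => by
      rw [eval_lineRestrict, eval_lineRestrict]
      have := hp.im_pderiv_div i (σ := 1) one_ne_zero
        (z := fun k => (z k : ℂ) + v k * w) (fun k => by
          have := mul_nonneg (hv k) hw.le
          simpa using this) (hcplx w hw.ne')
      simpa using this) ht
  refine ⟨d, hd, hd', ?_⟩
  rw [eval_lineRestrict_zero, eval_lineRestrict_zero, eval_lineRestrict, eval_lineRestrict] at hle
  simpa [barrier] using hle

lemma IsRealStable.barrier_anti {ι : Type*} {p : MvPolynomial ι ℂ} (hp : IsRealStable p)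
    (i : ι) {z y : ι → ℝ} (hz : IsAboveRoots p z) (hy : ∀ k, z k ≤ y k) :
    barrier p i y ≤ barrier p i z := by
  obtain ⟨d, hd, -, hle⟩ := hp.barrier_line i hz (v := fun k => y k - z k)
    (fun k => sub_nonneg.mpr (hy k)) zero_le_one
  simp only [mul_one, add_sub_cancel, one_mul] at hle
  linarith

lemma IsRealStable.isAboveRoots_sub_pderiv {ι : Type*} {p : MvPolynomial ι ℂ}
    (hp : IsRealStable p) {j : ι} {z : ι → ℝ} (hz : IsAboveRoots p z) (hj : barrier p j z < 1) :
    IsAboveRoots (p - pderiv j p) z := by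
  intro y hy h0
  have hpy := hz y hy
  have h1 := hp.barrier_anti j hz hy
  have h2 := hp.ofReal_barrier j hpy
  rw [map_sub, sub_eq_zero] at h0
  rw [← h0, div_self hpy] at h2
  have h3 : (1 : ℝ) = barrier p j y := by exact_mod_cast h2
  linarith

lemma pderiv_pderiv_comm {ι R : Type*} [CommRing R] (i j : ι) (p : MvPolynomial ι R) :
    pderiv i (pderiv j p) = pderiv j (pderiv i p) := by
  classical
  have h : ⁅pderiv (R := R) i, pderiv j⁆ = 0 := MvPolynomial.derivation_ext fun k => by
    rw [Derivation.commutator_apply, pderiv_X, pderiv_X, Pi.single_apply, Pi.single_apply]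
    split_ifs <;> simp
  rw [← sub_eq_zero, ← Derivation.commutator_apply, h, Derivation.zero_apply]

/-- Applying `1 - ∂ⱼ` and moving by `δ` in the direction `j` does not increase the barriers. -/
lemma IsRealStable.barrier_sub_pderiv_le {ι : Type*} [DecidableEq ι] {p : MvPolynomial ι ℂ}
    (hp : IsRealStable p) {j : ι} {z : ι → ℝ} (hz : IsAboveRoots p z) {δ : ℝ} (hδ : 0 < δ)
    (hj : barrier p j z ≤ 1 - 1 / δ) (i : ι) :
    barrier (p - pderiv j p) i (fun k => z k + (Pi.single j 1 : ι → ℝ) k * δ) ≤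
      barrier p i z := by
  have hv : ∀ k, 0 ≤ (Pi.single j 1 : ι → ℝ) k := fun k => by
    by_cases hk : k = j
    · subst hk
      simp
    · simp [hk]
  obtain ⟨d, hd, hd', hle⟩ := hp.barrier_line i hz hv hδ.le
  have hcast : (fun k => (((Pi.single j 1 : ι → ℝ) k : ℝ) : ℂ)) = (Pi.single j 1 : ι → ℂ) := by
    funext k
    by_cases hk : k = j
    · subst hk
      simp
    · simp [hk]
  set y : ι → ℝ := fun k => z k + (Pi.single j 1 : ι → ℝ) k * δ with hy
  have hzy : ∀ k, z k ≤ y k := fun k => by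
    have := mul_nonneg (hv k) hδ.le
    simp only [hy]
    linarith
  have hycast : (fun k => (z k : ℂ) + (Pi.single j 1 : ι → ℂ) k * (δ : ℂ)) =
      fun k => (y k : ℂ) := by
    rw [← hcast]
    funext k
    simp [hy]
  rw [hcast, derivative_lineRestrict_single, derivative_lineRestrict_single] at hd'
  simp only [eval_lineRestrict, hycast] at hd'
  have hpy := hz y hzy
  have hbj := hp.ofReal_barrier j hpy
  have hbi := hp.ofReal_barrier i hpy
  have hmono := hp.barrier_anti j hz hzy
  have hgap : 1 / δ ≤ 1 - barrier p j y := by linarith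
  have hgap0 : 0 < 1 - barrier p j y := lt_of_lt_of_le (by positivity) hgap
  have hcomm := pderiv_pderiv_comm i j p
  have hval : barrier (p - pderiv j p) i y = barrier p i y - d / (1 - barrier p j y) := by
    have hc : (1 - barrier p j y : ℂ) ≠ 0 := by exact_mod_cast hgap0.ne'
    have : eval (fun k => (y k : ℂ)) (pderiv i (p - pderiv j p)) /
        eval (fun k => (y k : ℂ)) (p - pderiv j p) =
        ((barrier p i y - d / (1 - barrier p j y) : ℝ) : ℂ) := by
      push_cast
      rw [map_sub, map_sub, map_sub, hcomm]
      rw [← hbj] at hc ⊢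
      rw [← hbi, ← hd']
      have hne : eval (fun k => (y k : ℂ)) p - eval (fun k => (y k : ℂ)) (pderiv j p) ≠ 0 := by
        intro h0
        rw [← sub_eq_zero.mp h0, div_self hpy, sub_self] at hc
        exact hc rfl
      field_simp
      ring
    rw [barrier, this, Complex.ofReal_re]
  have hfrac : -d / (1 - barrier p j y) ≤ -d * δ := by
    rw [div_le_iff₀ hgap0]
    rw [div_le_iff₀ hδ] at hgap
    nlinarith
  rw [hval]
  rw [neg_div] at hfrac
  linarith

/-- One application of `1 - ∂ₖ` per variable, each compensated by a shift by `δ`, keeps the barriers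
of the intermediate polynomials below `1 - 1 / δ`. -/
lemma IsRealStable.applyOps_barrier {m : ℕ} {p : MvPolynomial (Fin m) ℂ} (hp : IsRealStable p)
    {δ : ℝ} (hδ : 0 < δ) {z : Fin m → ℝ} (hz : IsAboveRoots p z)
    (hb : ∀ i, barrier p i z ≤ 1 - 1 / δ) (k : ℕ) (hk : k ≤ m) :
    IsRealStable (applyOps p k) ∧
      IsAboveRoots (applyOps p k) (fun i => z i + if (i : ℕ) < k then δ else 0) ∧
      ∀ i, barrier (applyOps p k) i (fun i => z i + if (i : ℕ) < k then δ else 0) ≤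
        1 - 1 / δ := by
  induction k with
  | zero => simpa [applyOps] using ⟨hp, hz, fun i => by simpa using hb i⟩
  | succ k ih =>
    obtain ⟨h1, h2, h3⟩ := ih (by omega)
    have hk' : k < m := by omega
    have hshift : (fun i : Fin m => z i + if (i : ℕ) < k + 1 then δ else 0) =
        fun i => (z i + if (i : ℕ) < k then δ else 0) +
          (Pi.single (⟨k, hk'⟩ : Fin m) 1 : Fin m → ℝ) i * δ := by
      funext i
      by_cases hi : i = ⟨k, hk'⟩
      · subst hi
        simp
      · have hne : (i : ℕ) ≠ k := fun h => hi (Fin.ext h)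
        have : (i : ℕ) < k + 1 ↔ (i : ℕ) < k := by omega
        simp [hi, this]
    have hdpos : 0 < 1 / δ := by positivity
    have happ : applyOps p (k + 1) =
        applyOps p k - pderiv (⟨k, hk'⟩ : Fin m) (applyOps p k) := by
      rw [applyOps, dif_pos hk']
    rw [happ]
    refine ⟨h1.sub_pderiv _, ?_, fun i => ?_⟩
    · have hbelow := h1.isAboveRoots_sub_pderiv h2 (j := ⟨k, hk'⟩) (by
        have := h3 ⟨k, hk'⟩
        linarith)
      intro y hy
      refine hbelow y fun i => (?_ : _ ≤ _).trans (hy i)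
      dsimp only
      split_ifs <;> first | omega | linarith
    · rw [hshift]
      exact (h1.barrier_sub_pderiv_le h2 hδ (h3 _) i).trans (h3 i)

/-- Positive semidefinite matrices summing to the identity have no singular combination with
coefficients in an open half plane. -/
lemma det_sum_smul_ne_zero {ι κ : Type*} [Fintype ι] [Fintype κ] [DecidableEq κ]
    {A : ι → Matrix κ κ ℂ} (hpsd : ∀ i, (A i).PosSemidef) (hsum : ∑ i, A i = 1) (c : ι → ℂ) (θ : ℂ)
    (hc : ∀ i, 0 < (θ * c i).re) : (∑ i, c i • A i).det ≠ 0 := by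
  intro hdet
  obtain ⟨v, hv0, hv⟩ := Matrix.exists_mulVec_eq_zero_iff.mpr hdet
  have hq : ∀ i, 0 ≤ star v ⬝ᵥ (A i).mulVec v := fun i => (hpsd i).dotProduct_mulVec_nonneg v
  have hqre : ∀ i, 0 ≤ (star v ⬝ᵥ (A i).mulVec v).re := fun i => (Complex.nonneg_iff.mp (hq i)).1
  have hqim : ∀ i, (star v ⬝ᵥ (A i).mulVec v).im = 0 := fun i =>
    (Complex.nonneg_iff.mp (hq i)).2.symm
  have h1 : ∑ i, c i * (star v ⬝ᵥ (A i).mulVec v) = 0 := by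
    have := congrArg (fun u => star v ⬝ᵥ u) hv
    simpa [Matrix.sum_mulVec, Matrix.smul_mulVec, dotProduct_sum] using this
  have h2 : ∑ i, (θ * c i).re * (star v ⬝ᵥ (A i).mulVec v).re = 0 := by
    have h := congrArg (fun u => (θ * u).re) h1
    simp only [Finset.mul_sum, Complex.re_sum, mul_zero, Complex.zero_re] at h
    rw [← h]
    refine Finset.sum_congr rfl fun i _ => ?_
    rw [← mul_assoc, Complex.mul_re (θ * c i), hqim, mul_zero, sub_zero]
  have h3 : ∀ i, (star v ⬝ᵥ (A i).mulVec v).re = 0 := by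
    intro i
    have := (Finset.sum_eq_zero_iff_of_nonneg
      fun i _ => mul_nonneg (hc i).le (hqre i)).mp h2 i (Finset.mem_univ i)
    exact (mul_eq_zero.mp this).resolve_left (hc i).ne'
  have h4 : star v ⬝ᵥ v = 0 := by
    have : star v ⬝ᵥ (∑ i, A i).mulVec v = 0 := by
      rw [Matrix.sum_mulVec, dotProduct_sum]
      exact Finset.sum_eq_zero fun i _ => Complex.ext (h3 i) (hqim i)
    simpa [hsum] using this
  exact hv0 (dotProduct_star_self_eq_zero.mp h4)

/-- The polynomial `det (x I + ∑ zᵢ Aᵢ)` in the variables `zᵢ`. -/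
noncomputable def detPencil {m n : ℕ} (A : Fin m → Matrix (Fin n) (Fin n) ℂ) (x : ℂ) :
    MvPolynomial (Fin m) ℂ :=
  Matrix.det
    (MvPolynomial.C (σ := Fin m) x • (1 : Matrix (Fin n) (Fin n) (MvPolynomial (Fin m) ℂ))
      + ∑ i, MvPolynomial.X (R := ℂ) i • (A i).map (MvPolynomial.C (σ := Fin m)))

lemma eval_detPencil {m n : ℕ} (A : Fin m → Matrix (Fin n) (Fin n) ℂ) (x : ℂ) (z : Fin m → ℂ) :
    eval z (detPencil A x) = (x • (1 : Matrix (Fin n) (Fin n) ℂ) + ∑ i, z i • A i).det := by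
  rw [detPencil, RingHom.map_det]
  congr 1
  ext a b
  simp [Matrix.sum_apply, Matrix.one_apply, apply_ite]

lemma eval_detPencil_of_sum_eq_one {m n : ℕ} {A : Fin m → Matrix (Fin n) (Fin n) ℂ}
    (hsum : ∑ i, A i = 1) (x : ℂ) (z : Fin m → ℂ) :
    eval z (detPencil A x) = (∑ i, (x + z i) • A i).det := by
  rw [eval_detPencil]
  simp only [add_smul, Finset.sum_add_distrib, ← Finset.smul_sum, hsum]

lemma isRealStable_detPencil {m n : ℕ} {A : Fin m → Matrix (Fin n) (Fin n) ℂ}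
    (hpsd : ∀ i, (A i).PosSemidef) (hsum : ∑ i, A i = 1) (x : ℝ) :
    IsRealStable (detPencil A x) := by
  intro σ _ z hz
  rw [eval_detPencil_of_sum_eq_one hsum]
  refine det_sum_smul_ne_zero hpsd hsum _ (-(σ * Complex.I)) fun i => ?_
  have := hz i
  simpa using this

lemma isAboveRoots_detPencil {m n : ℕ} {A : Fin m → Matrix (Fin n) (Fin n) ℂ}
    (hpsd : ∀ i, (A i).PosSemidef) (hsum : ∑ i, A i = 1) {x : ℝ} {z : Fin m → ℝ}
    (hz : ∀ i, 0 < x + z i) : IsAboveRoots (detPencil A x) z := by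
  intro y hy
  rw [eval_detPencil_of_sum_eq_one hsum]
  refine det_sum_smul_ne_zero hpsd hsum _ 1 fun i => ?_
  have h1 := hy i
  have h2 := hz i
  simp
  linarith

lemma barrier_detPencil_const {m n : ℕ} {A : Fin m → Matrix (Fin n) (Fin n) ℂ}
    (hsum : ∑ i, A i = 1) {x c : ℝ} (hc : 0 < x + c) (i : Fin m) :
    barrier (detPencil A x) i (fun _ => c) = (A i).trace.re / (x + c) := by
  have hτ : (x + c : ℂ) ≠ 0 := by exact_mod_cast hc.ne'
  set M : Matrix (Fin n) (Fin n) ℂ := (x + c : ℂ)⁻¹ • A i with hM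
  have hline : lineRestrict (detPencil A x) (fun _ => (c : ℂ)) (Pi.single i 1) =
      Polynomial.C ((x + c : ℂ) ^ n) *
        (1 + (Polynomial.X : Polynomial ℂ) • M.map Polynomial.C).det := by
    refine Polynomial.funext fun w => ?_
    rw [eval_lineRestrict, eval_detPencil_of_sum_eq_one hsum, Polynomial.eval_mul,
      Polynomial.eval_C, ← Polynomial.coe_evalRingHom, RingHom.map_det]
    have e1 : (Polynomial.evalRingHom w).mapMatrix
        (1 + (Polynomial.X : Polynomial ℂ) • M.map Polynomial.C) = 1 + w • M := by
      ext a b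
      simp [Matrix.one_apply, apply_ite, mul_comm w]
    have e2 : ∑ k, ((x : ℂ) + (c + (Pi.single i 1 : Fin m → ℂ) k * w)) • A k =
        (x + c : ℂ) • (1 + w • M) := by
      simp only [← add_assoc, add_smul _ (_ * w), Finset.sum_add_distrib, ← Finset.smul_sum, hsum]
      rw [Finset.sum_eq_single i (fun k _ hk => by simp [hk]) (by simp), smul_add, hM, smul_smul,
        smul_smul, mul_right_comm, mul_inv_cancel₀ hτ, Pi.single_eq_same]
    rw [e1, e2, Matrix.det_smul, Fintype.card_fin]
  have h0 : eval (fun _ => (c : ℂ)) (detPencil A x) = (x + c : ℂ) ^ n := by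
    rw [eval_detPencil_of_sum_eq_one hsum, ← Finset.smul_sum, hsum, Matrix.det_smul,
      Fintype.card_fin, Matrix.det_one, mul_one]
  have h1 : eval (fun _ => (c : ℂ)) (pderiv i (detPencil A x)) =
      (x + c : ℂ) ^ n * ((x + c : ℂ)⁻¹ * (A i).trace) := by
    rw [← eval_lineRestrict_zero _ _ (Pi.single i 1), ← derivative_lineRestrict_single, hline,
      Polynomial.derivative_C_mul, Polynomial.eval_mul, Polynomial.eval_C,
      Matrix.derivative_det_one_add_X_smul, hM, Matrix.trace_smul, smul_eq_mul]
  rw [barrier, h0, h1, mul_div_cancel_left₀ _ (pow_ne_zero n hτ), ← Complex.ofReal_add,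
    ← Complex.ofReal_inv, Complex.re_ofReal_mul]
  ring

theorem mixed_char_poly_root_bound {m n : ℕ} (A : Fin m → Matrix (Fin n) (Fin n) ℂ)
    (hpsd : ∀ i, (A i).PosSemidef) (hsum : ∑ i, A i = 1)
    (ε : ℝ) (hε : 0 < ε) (htr : ∀ i, (A i).trace.re ≤ ε) :
    ∀ x : ℝ,
      MvPolynomial.eval (fun _ => (0 : ℂ))
        (applyOps (Matrix.det
          (MvPolynomial.C (σ := Fin m) (x : ℂ) • (1 : Matrix (Fin n) (Fin n) (MvPolynomial (Fin m) ℂ))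
            + ∑ i, MvPolynomial.X (R := ℂ) i • (A i).map (MvPolynomial.C (σ := Fin m)))) m) = 0 →
      x ≤ (1 + Real.sqrt ε) ^ 2 := by
  intro x hx
  by_contra! hlt
  have hs : 0 < Real.sqrt ε := Real.sqrt_pos.mpr hε
  have hsq : Real.sqrt ε * Real.sqrt ε = ε := Real.mul_self_sqrt hε.le
  have hδ : 0 < 1 + Real.sqrt ε := by linarith
  have hτ : Real.sqrt ε * (1 + Real.sqrt ε) < x + -(1 + Real.sqrt ε) := by nlinarith
  have hτ0 : 0 < x + -(1 + Real.sqrt ε) := lt_trans (by positivity) hτ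
  have hb : ∀ i, barrier (detPencil A x) i (fun _ => -(1 + Real.sqrt ε)) ≤
      1 - 1 / (1 + Real.sqrt ε) := by
    intro i
    rw [barrier_detPencil_const hsum hτ0]
    have e : 1 - 1 / (1 + Real.sqrt ε) = ε / (Real.sqrt ε * (1 + Real.sqrt ε)) := by
      nth_rewrite 2 [← hsq]
      field_simp
      ring
    rw [e]
    exact div_le_div₀ hε.le (htr i) (by positivity) hτ.le
  have key := ((isRealStable_detPencil hpsd hsum x).applyOps_barrier hδ
    (isAboveRoots_detPencil hpsd hsum fun _ => hτ0) hb m le_rfl).2.1 (fun _ => 0) (by simp)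
  rw [Complex.ofReal_zero] at key
  exact key hx
end

section
/- Let v_1,...,v_m be independent random vectors in ℂ^n each taking finitely many values, with ∑_{i=1}^m E[v_i v_i*] = I and E[‖v_i‖²] ≤ ε for all i. Then there exists an assignment of outcomes w_1,...,w_m (each w_i in the support of v_i) such that the largest eigenvalue of ∑_{i=1}^m w_i w_i* is at most (1+√ε)². -/
open ComplexOrder

namespace KadisonSinger

open Polynomial Filter Topology

/-- The rational function `N / D` has no poles in the open upper half-plane and maps it to the
closed lower half-plane. -/
def MapsUpperToLower (N D : ℝ[X]) : Prop :=
  ∀ z : ℂ, 0 < z.im → aeval z D ≠ 0 ∧ (aeval z N / aeval z D).im ≤ 0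

lemma eq_zero_of_im_mul_pow_nonpos {c : ℝ} {m : ℕ} (hm : 2 ≤ m)
    (h : ∀ u : ℂ, 0 < u.im → ((c : ℂ) * u ^ m).im ≤ 0) : c = 0 := by
  have hm0 : (0 : ℝ) < m := by positivity
  have hmC : (m : ℂ) ≠ 0 := by exact_mod_cast hm0.ne'
  have hm2 : (2 : ℝ) ≤ m := by exact_mod_cast hm
  have key : ∀ θ : ℝ, 0 < θ → θ < Real.pi → c * Real.sin (m * θ) ≤ 0 := by
    intro θ h0 h1
    have := h (Complex.exp (θ * Complex.I)) (by
      rw [Complex.exp_ofReal_mul_I_im]; exact Real.sin_pos_of_pos_of_lt_pi h0 h1)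
    rwa [← Complex.exp_nat_mul, ← mul_assoc, Complex.im_ofReal_mul, ← Complex.ofReal_natCast,
      ← Complex.ofReal_mul, Complex.exp_ofReal_mul_I_im] at this
  have h1 := key (Real.pi / 2 / m) (by positivity) (by
    rw [div_lt_iff₀ hm0]; nlinarith [Real.pi_pos])
  have h2 := key ((Real.pi / 2 + Real.pi) / m) (by positivity) (by
    rw [div_lt_iff₀ hm0]; nlinarith [Real.pi_pos])
  rw [mul_div_cancel₀ _ hm0.ne'] at h1 h2
  rw [Real.sin_add_pi, Real.sin_pi_div_two] at h2
  rw [Real.sin_pi_div_two] at h1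
  linarith

lemma splits_of_forall_aeval_ne_zero {D : ℝ[X]}
    (hD : ∀ z : ℂ, 0 < z.im → aeval z D ≠ 0) : D.Splits := by
  refine Splits.of_splits_map_of_injective (i := algebraMap ℝ ℂ) Complex.ofReal_injective
    (IsAlgClosed.splits _) fun z hz => ?_
  have hz0 : aeval z D = 0 := by
    have := (mem_roots'.1 hz).2
    rwa [IsRoot, eval_map_algebraMap] at this
  have him : z.im = 0 := by
    rcases lt_trichotomy z.im 0 with h | h | h
    · refine absurd ?_ (hD (starRingEnd ℂ z) (by simpa using h))
      rw [aeval_conj, hz0, map_zero]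
    · exact h
    · exact absurd hz0 (hD z h)
  exact ⟨z.re, Complex.ext (by simp) (by simp [him])⟩

lemma MapsUpperToLower.im_residue_nonpos {N D E : ℝ[X]} {r : ℝ} {m : ℕ}
    (h : MapsUpperToLower N D) (hDE : D = (X - C r) ^ m * E) (hE : E.eval r ≠ 0)
    {u : ℂ} (hu : 0 < u.im) : (((N.eval r / E.eval r : ℝ) : ℂ) * u⁻¹ ^ m).im ≤ 0 := by
  have hu0 : u ≠ 0 := by rintro rfl; simp at hu
  have ht : Tendsto (fun δ : ℝ => (aeval ((r : ℂ) + δ * u) N / aeval ((r : ℂ) + δ * u) E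
      * u⁻¹ ^ m).im) (𝓝[>] 0) (𝓝 (((N.eval r / E.eval r : ℝ) : ℂ) * u⁻¹ ^ m).im) := by
    have hcont : ContinuousAt (fun δ : ℝ => (aeval ((r : ℂ) + δ * u) N /
        aeval ((r : ℂ) + δ * u) E * u⁻¹ ^ m).im) 0 := by
      have hev : ∀ P : ℝ[X], Continuous fun δ : ℝ => aeval ((r : ℂ) + δ * u) P := fun P =>
        P.continuous_aeval.comp (by fun_prop)
      refine Complex.continuous_im.continuousAt.comp (ContinuousAt.mul (ContinuousAt.div
        (hev N).continuousAt (hev E).continuousAt ?_) continuousAt_const)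
      have : aeval (r : ℂ) E = ((E.eval r : ℝ) : ℂ) := aeval_algebraMap_apply_eq_algebraMap_eval r E
      simp [this, hE]
    have := hcont.tendsto.mono_left (nhdsWithin_le_nhds (s := Set.Ioi 0))
    have hN : ∀ P : ℝ[X], aeval (r : ℂ) P = ((P.eval r : ℝ) : ℂ) := fun P =>
      aeval_algebraMap_apply_eq_algebraMap_eval r P
    simpa [hN] using this
  refine le_of_tendsto ht ?_
  filter_upwards [self_mem_nhdsWithin] with δ hδ
  have hδ : 0 < δ := hδ
  obtain ⟨h1, h2⟩ := h ((r : ℂ) + δ * u) (by simp; positivity)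
  rw [hDE] at h1 h2
  have e : aeval ((r : ℂ) + δ * u) N / aeval ((r : ℂ) + δ * u) E * u⁻¹ ^ m
      = ((δ ^ m : ℝ) : ℂ) * (aeval ((r : ℂ) + δ * u) N /
        aeval ((r : ℂ) + δ * u) ((X - C r) ^ m * E)) := by
    have hd : (δ : ℂ) ≠ 0 := by exact_mod_cast hδ.ne'
    have h3 : aeval ((r : ℂ) + δ * u) E ≠ 0 := fun h0 => h1 (by simp [h0])
    simp only [map_mul, map_pow, map_sub, aeval_X, aeval_C, Complex.coe_algebraMap]
    push_cast
    rw [add_sub_cancel_left, inv_pow, mul_pow]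
    field_simp
  rw [e, Complex.im_ofReal_mul]
  exact mul_nonpos_of_nonneg_of_nonpos (by positivity) h2

/-- Rescaling a polynomial at infinity isolates its leading term. -/
lemma tendsto_pow_mul_aeval_div (P : ℝ[X]) (u : ℂ) :
    Tendsto (fun δ : ℝ => (δ : ℂ) ^ P.natDegree * aeval (u / δ) P) (𝓝[>] 0)
      (𝓝 (P.leadingCoeff * u ^ P.natDegree)) := by
  have hcont : Continuous fun δ : ℝ => ∑ k ∈ Finset.range (P.natDegree + 1),
      (P.coeff k : ℂ) * u ^ k * (δ : ℂ) ^ (P.natDegree - k) := by fun_prop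
  have h0 := (hcont.tendsto 0).mono_left (nhdsWithin_le_nhds (s := Set.Ioi 0))
  have e0 : ∑ k ∈ Finset.range (P.natDegree + 1),
      (P.coeff k : ℂ) * u ^ k * ((0 : ℝ) : ℂ) ^ (P.natDegree - k)
      = P.leadingCoeff * u ^ P.natDegree := by
    rw [Finset.sum_range_succ, Finset.sum_eq_zero]
    · simp
    · intro k hk
      have : P.natDegree - k ≠ 0 := by have := Finset.mem_range.1 hk; omega
      simp [this]
  rw [e0] at h0
  refine h0.congr' ?_
  filter_upwards [self_mem_nhdsWithin] with δ hδ
  have hd : (δ : ℂ) ≠ 0 := by exact_mod_cast (ne_of_gt hδ)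
  rw [aeval_eq_sum_range, Finset.mul_sum]
  refine Finset.sum_congr rfl fun k hk => ?_
  have hk : k ≤ P.natDegree := by have := Finset.mem_range.1 hk; omega
  obtain ⟨d, hd'⟩ := Nat.exists_eq_add_of_le hk
  rw [hd', Nat.add_sub_cancel_left, pow_add, Complex.real_smul, div_pow]
  field_simp

lemma MapsUpperToLower.im_leadingCoeff_nonpos {N D : ℝ[X]} (h : MapsUpperToLower N D)
    (hD : D ≠ 0) {d : ℕ} (hd : N.natDegree = D.natDegree + d) {u : ℂ} (hu : 0 < u.im) :
    (((N.leadingCoeff / D.leadingCoeff : ℝ) : ℂ) * u ^ d).im ≤ 0 := by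
  have hu0 : u ≠ 0 := by rintro rfl; simp at hu
  have hl : (D.leadingCoeff : ℂ) ≠ 0 := by exact_mod_cast leadingCoeff_ne_zero.2 hD
  have ht := (tendsto_pow_mul_aeval_div N u).div (tendsto_pow_mul_aeval_div D u)
    (mul_ne_zero hl (pow_ne_zero _ hu0))
  have e : (N.leadingCoeff : ℂ) * u ^ N.natDegree / (D.leadingCoeff * u ^ D.natDegree)
      = ((N.leadingCoeff / D.leadingCoeff : ℝ) : ℂ) * u ^ d := by
    rw [hd, pow_add]; push_cast; field_simp
  rw [e] at ht
  refine le_of_tendsto ((Complex.continuous_im.tendsto _).comp ht) ?_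
  filter_upwards [self_mem_nhdsWithin] with δ hδ
  have hδ : 0 < δ := hδ
  have hd0 : (δ : ℂ) ≠ 0 := by exact_mod_cast hδ.ne'
  obtain ⟨h1, h2⟩ := h (u / δ) (by
    rw [Complex.div_ofReal_im]; positivity)
  have e2 : (δ : ℂ) ^ N.natDegree * aeval (u / δ) N / ((δ : ℂ) ^ D.natDegree * aeval (u / δ) D)
      = ((δ ^ d : ℝ) : ℂ) * (aeval (u / δ) N / aeval (u / δ) D) := by
    rw [hd, pow_add]; push_cast; field_simp
  show ((δ : ℂ) ^ N.natDegree * aeval (u / δ) N / ((δ : ℂ) ^ D.natDegree * aeval (u / δ) D)).im ≤ 0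
  rw [e2, Complex.im_ofReal_mul]
  exact mul_nonpos_of_nonneg_of_nonpos (by positivity) h2

lemma natDegree_div (N : ℝ[X]) {D : ℝ[X]} (hD : D ≠ 0) :
    (N / D).natDegree = N.natDegree - D.natDegree := by
  have hl : D.leadingCoeff⁻¹ ≠ 0 := inv_ne_zero (leadingCoeff_ne_zero.2 hD)
  rw [div_def, natDegree_C_mul hl, natDegree_divByMonic _ (monic_mul_leadingCoeff_inv hD),
    natDegree_mul_C hl]

lemma MapsUpperToLower.ne_zero {N D : ℝ[X]} (h : MapsUpperToLower N D) : D ≠ 0 := by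
  rintro rfl
  exact (h Complex.I (by simp)).1 (by simp)

lemma MapsUpperToLower.rootMultiplicity_le_one {N D : ℝ[X]} (h : MapsUpperToLower N D)
    (hND : IsCoprime N D) (r : ℝ) : D.rootMultiplicity r ≤ 1 := by
  by_contra! hm
  obtain ⟨E, hDE, hE⟩ := exists_eq_pow_rootMultiplicity_mul_and_not_dvd D h.ne_zero r
  rw [dvd_iff_isRoot, IsRoot] at hE
  set m := D.rootMultiplicity r
  have hc : (-1) ^ m * (N.eval r / E.eval r) = 0 := by
    refine eq_zero_of_im_mul_pow_nonpos hm fun w hw => ?_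
    have hw0 : w ≠ 0 := by rintro rfl; simp at hw
    have := h.im_residue_nonpos hDE hE (u := -w⁻¹) (by
      rw [Complex.neg_im, Complex.inv_im]
      have := Complex.normSq_pos.2 hw0
      rw [neg_div, neg_neg]; positivity)
    convert this using 2
    rw [inv_neg, inv_inv, neg_pow w]
    push_cast
    ring
  have hNr : N.eval r = 0 := by simpa [hE] using hc
  have hDr : D.eval r = 0 := by
    rw [hDE]; simp [show m ≠ 0 by omega]
  obtain ⟨a, b, hab⟩ := hND
  have := congrArg (eval r) hab
  simp [hNr, hDr] at this

lemma MapsUpperToLower.exists_partialFractions_of_isCoprime {N D : ℝ[X]}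
    (h : MapsUpperToLower N D) (hND : IsCoprime N D) :
    ∃ (s : Finset ℝ) (c : ℝ → ℝ) (α β : ℝ), (∀ r ∈ s, D.eval r = 0 ∧ 0 ≤ c r) ∧ α ≤ 0 ∧
      ∀ x, D.eval x ≠ 0 → N.eval x / D.eval x = α * x + β + ∑ r ∈ s, c r / (x - r) := by
  have hD0 := h.ne_zero
  have hs : D.Splits := splits_of_forall_aeval_ne_zero fun z hz => (h z hz).1
  have hlc : D.leadingCoeff ≠ 0 := leadingCoeff_ne_zero.2 hD0
  set s := D.roots.toFinset with hsdef
  have hnod : D.roots.Nodup := Multiset.nodup_iff_count_le_one.2 fun r => by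
    rw [count_roots]; exact h.rootMultiplicity_le_one hND r
  have hDs : D = C D.leadingCoeff * Lagrange.nodal s id := by
    conv_lhs => rw [hs.eq_prod_roots]
    rw [Lagrange.nodal, Finset.prod, hsdef, Multiset.toFinset_val, hnod.dedup]
    rfl
  have hroot : ∀ r ∈ s, D.eval r = 0 := fun r hr => by
    have := Multiset.mem_toFinset.1 hr
    exact (mem_roots'.1 this).2
  have hdeg : D.degree = s.card := by
    rw [hDs, degree_C_mul hlc, Lagrange.degree_nodal]
  have hnat : N.natDegree ≤ D.natDegree + 1 := by
    by_contra! hlt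
    have hc := eq_zero_of_im_mul_pow_nonpos (c := N.leadingCoeff / D.leadingCoeff)
      (m := N.natDegree - D.natDegree) (by omega)
      fun u hu => h.im_leadingCoeff_nonpos hD0 (by omega) hu
    have hN0 : N = 0 := by simpa [hD0] using hc
    simp [hN0] at hlt
  have hQ : (N / D).natDegree ≤ 1 := by
    rw [natDegree_div _ hD0]; omega
  refine ⟨s, fun r => D.leadingCoeff⁻¹ * Lagrange.nodalWeight s id r * N.eval r,
    (N / D).coeff 1, (N / D).coeff 0, fun r hr => ⟨hroot r hr, ?_⟩, ?_, fun x hx => ?_⟩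
  · have := h.im_residue_nonpos (r := r) (m := 1)
      (E := C D.leadingCoeff * Lagrange.nodal (s.erase r) id) (by
        conv_lhs => rw [hDs, Lagrange.nodal_eq_mul_nodal_erase hr]
        simp only [id]; ring) (by
        rw [eval_mul, eval_C]
        refine mul_ne_zero hlc (Lagrange.eval_nodal_not_at_node fun i hi => ?_)
        exact (Finset.ne_of_mem_erase hi).symm) (u := Complex.I) (by simp)
    rw [Complex.im_ofReal_mul, pow_one, Complex.inv_I, Complex.neg_im, Complex.I_im,
      eval_mul, eval_C] at this
    show 0 ≤ D.leadingCoeff⁻¹ * Lagrange.nodalWeight s id r * eval r N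
    rw [Lagrange.nodalWeight_eq_eval_nodal_erase_inv, ← mul_inv]
    simp only [id]
    rw [inv_mul_eq_div]
    linarith
  · rcases hnat.lt_or_eq with hlt | heq
    · rw [coeff_eq_zero_of_natDegree_lt]
      rw [natDegree_div _ hD0]; omega
    · have := h.im_leadingCoeff_nonpos hD0 heq (u := Complex.I) (by simp)
      rw [Complex.im_ofReal_mul, pow_one, Complex.I_im, mul_one, ← leadingCoeff_div] at this
      · rwa [leadingCoeff, natDegree_div _ hD0, heq, Nat.add_sub_cancel_left] at this
      · exact (natDegree_lt_natDegree_iff hD0).1 (by omega) |>.le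
  · have hx' : ∀ i ∈ s, x ≠ id i := fun i hi hxi => hx (by rw [hxi]; exact hroot i hi)
    have hR : (N % D).eval x = (Lagrange.nodal s id).eval x *
        ∑ r ∈ s, Lagrange.nodalWeight s id r * (x - r)⁻¹ * N.eval r := by
      have e1 := Lagrange.eq_interpolate (f := N % D) (s := s) (v := id)
        Function.injective_id.injOn (by rw [← hdeg]; exact degree_mod_lt _ hD0)
      rw [e1, Lagrange.eval_interpolate_not_at_node _ hx']
      congr 1
      refine Finset.sum_congr rfl fun r hr => ?_
      congr 1
      have := congrArg (eval r) (EuclideanDomain.div_add_mod N D)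
      simpa [hroot r hr] using this
    have hN : N.eval x = D.eval x * (N / D).eval x + (N % D).eval x := by
      rw [← eval_mul, ← eval_add, EuclideanDomain.div_add_mod]
    have hQx : (N / D).eval x = (N / D).coeff 1 * x + (N / D).coeff 0 := by
      conv_lhs => rw [eq_X_add_C_of_natDegree_le_one hQ]
      simp
    have hDx : D.eval x = D.leadingCoeff * (Lagrange.nodal s id).eval x := by
      conv_lhs => rw [hDs]
      simp
    have hnx : (Lagrange.nodal s id).eval x ≠ 0 := Lagrange.eval_nodal_not_at_node hx'
    rw [hN, add_div, mul_div_cancel_left₀ _ hx, hQx, hR, hDx, mul_comm D.leadingCoeff,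
      mul_div_mul_left _ _ hnx, Finset.sum_div]
    congr 1
    refine Finset.sum_congr rfl fun r _ => ?_
    ring

lemma MapsUpperToLower.exists_partialFractions {N D : ℝ[X]} (h : MapsUpperToLower N D) :
    ∃ (s : Finset ℝ) (c : ℝ → ℝ) (α β : ℝ), (∀ r ∈ s, D.eval r = 0 ∧ 0 ≤ c r) ∧ α ≤ 0 ∧
      ∀ x, D.eval x ≠ 0 → N.eval x / D.eval x = α * x + β + ∑ r ∈ s, c r / (x - r) := by
  have hD0 := h.ne_zero
  set G := GCDMonoid.gcd N D
  have hN : N = G * (N / G) :=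
    (EuclideanDomain.mul_div_cancel' (gcd_ne_zero_of_right hD0) (gcd_dvd_left _ _)).symm
  have hD : D = G * (D / G) :=
    (EuclideanDomain.mul_div_cancel' (gcd_ne_zero_of_right hD0) (gcd_dvd_right _ _)).symm
  have h' : MapsUpperToLower (N / G) (D / G) := fun z hz => by
    obtain ⟨h1, h2⟩ := h z hz
    rw [hN, hD, map_mul, map_mul] at h2
    rw [hD, map_mul] at h1
    refine ⟨right_ne_zero_of_mul h1, ?_⟩
    rwa [mul_div_mul_left _ _ (left_ne_zero_of_mul h1)] at h2
  obtain ⟨s, c, α, β, h1, h2, h3⟩ :=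
    h'.exists_partialFractions_of_isCoprime (isCoprime_div_gcd_div_gcd hD0)
  refine ⟨s, c, α, β, fun r hr => ⟨?_, (h1 r hr).2⟩, h2, fun x hx => ?_⟩
  · rw [hD, eval_mul, (h1 r hr).1, mul_zero]
  · rw [hD, eval_mul] at hx
    rw [← h3 x (right_ne_zero_of_mul hx)]
    conv_lhs => rw [hN, hD, eval_mul, eval_mul, mul_div_mul_left _ _ (left_ne_zero_of_mul hx)]

/-- To the right of its poles, `N / D` is antitone, and lies above its tangents. -/
lemma MapsUpperToLower.antitone_and_tangent {N D : ℝ[X]} (h : MapsUpperToLower N D) {a b : ℝ}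
    (hab : a ≤ b) (hpos : ∀ x, a ≤ x → 0 < D.eval x) :
    N.eval b / D.eval b ≤ N.eval a / D.eval a ∧
    (derivative N).eval b * D.eval b - N.eval b * (derivative D).eval b ≤ 0 ∧
    N.eval b / D.eval b - (b - a) * (((derivative N).eval b * D.eval b -
      N.eval b * (derivative D).eval b) / D.eval b ^ 2) ≤ N.eval a / D.eval a := by
  obtain ⟨s, c, α, β, hs, hα, hf⟩ := h.exists_partialFractions
  have hra : ∀ r ∈ s, r < a := fun r hr => by
    by_contra! hc
    exact (hpos r hc).ne' (hs r hr).1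
  have hDb := hpos b hab
  have hd1 : HasDerivAt (fun x => N.eval x / D.eval x) (((derivative N).eval b * D.eval b -
      N.eval b * (derivative D).eval b) / D.eval b ^ 2) b :=
    (N.hasDerivAt b).fun_div (D.hasDerivAt b) hDb.ne'
  have hd2 : HasDerivAt (fun x => α * x + β + ∑ r ∈ s, c r / (x - r))
      (α - ∑ r ∈ s, c r / (b - r) ^ 2) b := by
    have hsum : HasDerivAt (fun x => ∑ r ∈ s, c r / (x - r))
        (∑ r ∈ s, -(c r / (b - r) ^ 2)) b := by
      refine HasDerivAt.fun_sum fun r hr => ?_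
      have hbr : b - r ≠ 0 := by have := hra r hr; linarith
      have := ((hasDerivAt_id b).sub_const r).fun_inv hbr |>.const_mul (c r)
      simpa only [id, div_eq_mul_inv, neg_mul, mul_neg, one_mul] using this
    refine ((((hasDerivAt_id b).const_mul α).add_const β).fun_add hsum).congr_deriv ?_
    rw [Finset.sum_neg_distrib, mul_one, sub_eq_add_neg]
  have hder := hd1.unique (hd2.congr_of_eventuallyEq (by
    filter_upwards [D.continuous.continuousAt.eventually_ne hDb.ne'] with x hx using hf x hx))
  have hge : 0 ≤ ∑ r ∈ s, c r / (b - r) ^ 2 := Finset.sum_nonneg fun r hr => by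
    have := (hs r hr).2; positivity
  have htan : (∑ r ∈ s, c r / (b - r)) + (b - a) * ∑ r ∈ s, c r / (b - r) ^ 2 ≤
      ∑ r ∈ s, c r / (a - r) := by
    rw [Finset.mul_sum, ← Finset.sum_add_distrib]
    refine Finset.sum_le_sum fun r hr => ?_
    have hc := (hs r hr).2
    have h1 : 0 < a - r := by have := hra r hr; linarith
    have h2 : 0 < b - r := by linarith
    have e : c r / (a - r) - (c r / (b - r) + (b - a) * (c r / (b - r) ^ 2))
        = c r * (b - a) ^ 2 / ((a - r) * (b - r) ^ 2) := by
      field_simp; ring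
    have : 0 ≤ c r * (b - a) ^ 2 / ((a - r) * (b - r) ^ 2) := by positivity
    linarith
  have hb0 : 0 ≤ b - a := by linarith
  have hfinal : N.eval b / D.eval b - (b - a) * (((derivative N).eval b * D.eval b -
      N.eval b * (derivative D).eval b) / D.eval b ^ 2) ≤ N.eval a / D.eval a := by
    rw [hder, hf b hDb.ne', hf a (hpos a le_rfl).ne']
    nlinarith
  have hneg : ((derivative N).eval b * D.eval b -
      N.eval b * (derivative D).eval b) / D.eval b ^ 2 ≤ 0 := by rw [hder]; linarith
  refine ⟨?_, ?_, hfinal⟩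
  · nlinarith [mul_nonneg hb0 (neg_nonneg.2 hneg)]
  · by_contra! hc
    exact absurd hneg (not_le.2 (by positivity))

variable {n : Type*}

/-- Polynomial functions of the entries of a square complex matrix. -/
abbrev MatPoly (n : Type*) := MvPolynomial (n × n) ℂ

/-- Evaluation of a polynomial in the matrix entries at a matrix. -/
noncomputable def evalAt (M : Matrix n n ℂ) : MatPoly n →ₐ[ℂ] ℂ :=
  MvPolynomial.aeval fun ij => M ij.1 ij.2

/-- The real part of the value at a matrix; it is the value itself for polynomials that are real
on Hermitian matrices. -/
noncomputable def val (P : MatPoly n) (M : Matrix n n ℂ) : ℝ := (evalAt M P).re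

/-- Directional derivative in the direction of a matrix. -/
noncomputable def dirDeriv (A : Matrix n n ℂ) : Derivation ℂ (MatPoly n) (MatPoly n) :=
  MvPolynomial.mkDerivation ℂ fun ij => MvPolynomial.C (A ij.1 ij.2)

/-- Restriction of a polynomial to the line `z ↦ M + z • B`. -/
noncomputable def line (M B : Matrix n n ℂ) : MatPoly n →ₐ[ℂ] ℂ[X] :=
  MvPolynomial.aeval fun ij => C (M ij.1 ij.2) + X * C (B ij.1 ij.2)

lemma eval_line (M B : Matrix n n ℂ) (P : MatPoly n) (z : ℂ) :
    (line M B P).eval z = evalAt (M + z • B) P := by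
  have : (aeval z).comp (line M B) = evalAt (M + z • B) := by
    ext ij
    simp [line, evalAt]
    ring
  rw [← this, AlgHom.comp_apply, coe_aeval_eq_eval]

lemma derivative_line (M B : Matrix n n ℂ) (P : MatPoly n) :
    derivative (line M B P) = line M B (dirDeriv B P) := by
  induction P using MvPolynomial.induction_on with
  | C a => simp [line, MvPolynomial.algHom_C]
  | add p q hp hq => simp [hp, hq]
  | mul_X p i hp =>
    rw [map_mul, derivative_mul, hp, Derivation.leibniz, map_add, smul_eq_mul, smul_eq_mul,
      map_mul, map_mul]
    simp [line, dirDeriv, MvPolynomial.mkDerivation_X]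
    ring

lemma dirDeriv_add (A B : Matrix n n ℂ) (P : MatPoly n) :
    dirDeriv (A + B) P = dirDeriv A P + dirDeriv B P := by
  rw [← Derivation.add_apply]
  congr 1
  ext ij
  simp [dirDeriv, MvPolynomial.mkDerivation_X]

lemma dirDeriv_smul (c : ℂ) (A : Matrix n n ℂ) (P : MatPoly n) :
    dirDeriv (c • A) P = c • dirDeriv A P := by
  rw [← Derivation.smul_apply]
  congr 1
  ext ij
  simp [dirDeriv, MvPolynomial.mkDerivation_X]

lemma dirDeriv_sum {ι : Type*} (s : Finset ι) (A : ι → Matrix n n ℂ) (P : MatPoly n) :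
    dirDeriv (∑ i ∈ s, A i) P = ∑ i ∈ s, dirDeriv (A i) P := by
  classical
  induction s using Finset.induction_on with
  | empty => simpa using dirDeriv_smul 0 0 P
  | insert i s hi ih => rw [Finset.sum_insert hi, Finset.sum_insert hi, dirDeriv_add, ih]

lemma dirDeriv_comm (A B : Matrix n n ℂ) (P : MatPoly n) :
    dirDeriv A (dirDeriv B P) = dirDeriv B (dirDeriv A P) := by
  have : ⁅dirDeriv A, dirDeriv B⁆ = 0 := by
    ext ij
    simp [Derivation.commutator_apply, dirDeriv, MvPolynomial.mkDerivation_X]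
  have := congrArg (fun D => D P) this
  simpa [Derivation.commutator_apply, sub_eq_zero] using this

lemma evalAt_dirDeriv (M B : Matrix n n ℂ) (P : MatPoly n) :
    evalAt M (dirDeriv B P) = (derivative (line M B P)).eval 0 := by
  rw [derivative_line, eval_line, zero_smul, add_zero]

/-- The polynomial commutes with conjugation; in particular it is real on Hermitian matrices. -/
def ConjInvariant (P : MatPoly n) : Prop :=
  ∀ M : Matrix n n ℂ, evalAt M.conjTranspose P = starRingEnd ℂ (evalAt M P)

lemma ConjInvariant.line_conjTranspose {P : MatPoly n} (hP : ConjInvariant P)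
    (M : Matrix n n ℂ) {B : Matrix n n ℂ} (hB : B.IsHermitian) :
    line M.conjTranspose B P = (line M B P).map (starRingEnd ℂ) := by
  refine Polynomial.funext fun z => ?_
  have h := eval_map_apply (starRingEnd ℂ) (p := line M B P) (starRingEnd ℂ z)
  rw [Complex.conj_conj] at h
  rw [eval_line, h, eval_line, ← hP, Matrix.conjTranspose_add, Matrix.conjTranspose_smul, hB.eq]
  simp

lemma ConjInvariant.dirDeriv {P : MatPoly n} (hP : ConjInvariant P) {A : Matrix n n ℂ}
    (hA : A.IsHermitian) : ConjInvariant (dirDeriv A P) := fun M => by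
  rw [evalAt_dirDeriv, evalAt_dirDeriv, hP.line_conjTranspose M hA, derivative_map]
  have := eval_map_apply (starRingEnd ℂ) (p := derivative (line M A P)) 0
  rwa [map_zero] at this

lemma ConjInvariant.sub {P Q : MatPoly n} (hP : ConjInvariant P) (hQ : ConjInvariant Q) :
    ConjInvariant (P - Q) := fun M => by
  rw [map_sub, map_sub, map_sub, hP, hQ]

lemma ConjInvariant.exists_realLine {P : MatPoly n} (hP : ConjInvariant P)
    {H B : Matrix n n ℂ} (hH : H.IsHermitian) (hB : B.IsHermitian) :
    ∃ f : ℝ[X], f.map (algebraMap ℝ ℂ) = line H B P := by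
  have h := hP.line_conjTranspose H hB
  rw [hH.eq] at h
  have hl : line H B P ∈ lifts (algebraMap ℝ ℂ) := by
    rw [lifts_iff_coeff_lifts]
    intro k
    have hk := congrArg (fun f => coeff f k) h
    simp only [coeff_map] at hk
    exact ⟨_, Complex.conj_eq_iff_re.1 hk.symm⟩
  exact (mem_lifts _).1 hl

lemma eval_of_map_eq_line {P : MatPoly n} {H B : Matrix n n ℂ} {f : ℝ[X]}
    (hf : f.map (algebraMap ℝ ℂ) = line H B P) (x : ℝ) :
    f.eval x = val P (H + (x : ℂ) • B) := by
  rw [val, ← eval_line, ← hf, eval_map_algebraMap]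
  have : aeval (x : ℂ) f = ((f.eval x : ℝ) : ℂ) := aeval_algebraMap_apply_eq_algebraMap_eval x f
  rw [this, Complex.ofReal_re]

lemma derivative_map_eq_line {P : MatPoly n} {H B : Matrix n n ℂ} {f : ℝ[X]}
    (hf : f.map (algebraMap ℝ ℂ) = line H B P) :
    (derivative f).map (algebraMap ℝ ℂ) = line H B (dirDeriv B P) := by
  rw [← derivative_map, hf, derivative_line]

/-- Real on Hermitian matrices and without zeros at matrices with positive definite imaginary
part. -/
structure IsStable (P : MatPoly n) : Prop where
  conj : ConjInvariant P
  ne_zero : ∀ {H B : Matrix n n ℂ}, H.IsHermitian → B.PosDef → evalAt (H + Complex.I • B) P ≠ 0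

lemma derivative_div_eq_zero_or_im_neg {f : ℂ[X]} (hf : ∀ z : ℂ, 0 ≤ z.im → f.eval z ≠ 0) :
    (derivative f).eval 0 / f.eval 0 = 0 ∨ ((derivative f).eval 0 / f.eval 0).im < 0 := by
  rw [(IsAlgClosed.splits f).eval_derivative_div_eval_of_ne_zero (hf 0 le_rfl)]
  have : ∀ s : Multiset ℂ, (∀ r ∈ s, r.im < 0) →
      (s.map fun r => 1 / (0 - r)).sum = 0 ∨ ((s.map fun r => 1 / (0 - r)).sum).im < 0 := by
    intro s
    induction s using Multiset.induction_on with
    | empty => simp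
    | cons a s ih =>
      intro h
      rw [Multiset.map_cons, Multiset.sum_cons, Complex.add_im]
      have h1 := ih fun r hr => h r (Multiset.mem_cons_of_mem hr)
      have h2 := h a (Multiset.mem_cons_self a s)
      have h3 : (1 / (0 - a)).im < 0 := by
        rw [zero_sub, one_div, Complex.inv_im, Complex.neg_im, neg_neg, Complex.normSq_neg]
        exact div_neg_of_neg_of_pos h2 (Complex.normSq_pos.2 fun h0 => by simp [h0] at h2)
      right
      rcases h1 with h1 | h1
      · rwa [h1, Complex.zero_im, add_zero]
      · linarith
  refine this _ fun r hr => ?_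
  by_contra! hc
  exact hf r hc (mem_roots'.1 hr).2

lemma isHermitian_add_smul {H A : Matrix n n ℂ} (hH : H.IsHermitian) (hA : A.IsHermitian)
    (x : ℝ) : (H + (x : ℂ) • A).IsHermitian :=
  hH.add (by rw [Matrix.IsHermitian, Matrix.conjTranspose_smul, hA.eq]; simp)

lemma posSemidef_smul {A : Matrix n n ℂ} (hA : A.PosSemidef) {x : ℝ} (hx : 0 ≤ x) :
    ((x : ℂ) • A).PosSemidef :=
  hA.smul (by exact_mod_cast hx)

lemma IsStable.line_ne_zero {P : MatPoly n} (hP : IsStable P) {H B A : Matrix n n ℂ}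
    (hH : H.IsHermitian) (hB : B.PosDef) (hA : A.PosSemidef) {z : ℂ} (hz : 0 ≤ z.im) :
    (line (H + Complex.I • B) A P).eval z ≠ 0 := by
  rw [eval_line]
  have : H + Complex.I • B + z • A =
      (H + (z.re : ℂ) • A) + Complex.I • (B + (z.im : ℂ) • A) := by
    conv_lhs => rw [← Complex.re_add_im z]
    module
  rw [this]
  exact hP.ne_zero (isHermitian_add_smul hH hA.isHermitian _)
    (hB.add_posSemidef (posSemidef_smul hA hz))

lemma IsStable.im_dirDeriv_div_nonpos {P : MatPoly n} (hP : IsStable P) {H B A : Matrix n n ℂ}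
    (hH : H.IsHermitian) (hB : B.PosDef) (hA : A.PosSemidef) :
    (evalAt (H + Complex.I • B) (dirDeriv A P) / evalAt (H + Complex.I • B) P).im ≤ 0 := by
  have h0 : (line (H + Complex.I • B) A P).eval 0 = evalAt (H + Complex.I • B) P := by
    rw [eval_line, zero_smul, add_zero]
  have := derivative_div_eq_zero_or_im_neg fun z hz => hP.line_ne_zero hH hB hA (z := z) hz
  rw [← evalAt_dirDeriv, h0] at this
  rcases this with h | h
  · rw [h, Complex.zero_im]
  · exact h.le

lemma IsStable.sub_dirDeriv {P : MatPoly n} (hP : IsStable P) {A : Matrix n n ℂ}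
    (hA : A.PosSemidef) : IsStable (P - dirDeriv A P) where
  conj := hP.conj.sub (hP.conj.dirDeriv hA.isHermitian)
  ne_zero {H B} hH hB h0 := by
    have hne := hP.ne_zero hH hB
    have h0' : (line (H + Complex.I • B) A P).eval 0 = evalAt (H + Complex.I • B) P := by
      rw [eval_line, zero_smul, add_zero]
    have := derivative_div_eq_zero_or_im_neg fun z hz => hP.line_ne_zero hH hB hA (z := z) hz
    rw [map_sub, sub_eq_zero] at h0
    rw [← evalAt_dirDeriv, h0', ← h0, div_self hne] at this
    simp at this

lemma aeval_of_map_eq_line {P : MatPoly n} {H B : Matrix n n ℂ} {f : ℝ[X]}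
    (hf : f.map (algebraMap ℝ ℂ) = line H B P) (z : ℂ) :
    aeval z f = evalAt (H + z • B) P := by
  rw [← eval_line, ← hf, eval_map_algebraMap]

lemma IsStable.mapsUpperToLower {P : MatPoly n} (hP : IsStable P) {H B A : Matrix n n ℂ}
    (hH : H.IsHermitian) (hB : B.PosDef) (hA : A.PosSemidef) {f g : ℝ[X]}
    (hf : f.map (algebraMap ℝ ℂ) = line H B P)
    (hg : g.map (algebraMap ℝ ℂ) = line H B (dirDeriv A P)) : MapsUpperToLower g f := by
  intro z hz
  have hH' := isHermitian_add_smul hH hB.isHermitian z.re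
  have hB' : ((z.im : ℂ) • B).PosDef := hB.smul (by exact_mod_cast hz)
  have : H + z • B = (H + (z.re : ℂ) • B) + Complex.I • ((z.im : ℂ) • B) := by
    conv_lhs => rw [← Complex.re_add_im z]
    module
  rw [aeval_of_map_eq_line hf, aeval_of_map_eq_line hg, this]
  exact ⟨hP.ne_zero hH' hB', hP.im_dirDeriv_div_nonpos hH' hB' hA⟩

/-- The logarithmic derivative of `P` at `M` in the direction `A`. -/
noncomputable def barrier (A : Matrix n n ℂ) (P : MatPoly n) (M : Matrix n n ℂ) : ℝ :=
  val (dirDeriv A P) M / val P M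

/-- The derivative of `barrier A P` at `M` in the direction `B`. -/
noncomputable def barrierSlope (A B : Matrix n n ℂ) (P : MatPoly n) (M : Matrix n n ℂ) : ℝ :=
  (val (dirDeriv B (dirDeriv A P)) M * val P M - val (dirDeriv A P) M * val (dirDeriv B P) M) /
    val P M ^ 2

lemma IsStable.barrier_posDef {P : MatPoly n} (hP : IsStable P) {H B A : Matrix n n ℂ}
    (hH : H.IsHermitian) (hB : B.PosDef) (hA : A.PosSemidef)
    (hpos : ∀ x : ℝ, 0 ≤ x → 0 < val P (H + (x : ℂ) • B)) :
    barrier A P (H + B) ≤ barrier A P H ∧ barrierSlope A B P (H + B) ≤ 0 ∧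
      barrier A P (H + B) - barrierSlope A B P (H + B) ≤ barrier A P H := by
  obtain ⟨f, hf⟩ := hP.conj.exists_realLine hH hB.isHermitian
  obtain ⟨g, hg⟩ := (hP.conj.dirDeriv hA.isHermitian).exists_realLine hH hB.isHermitian
  have h := (hP.mapsUpperToLower hH hB hA hf hg).antitone_and_tangent zero_le_one
    fun x hx => (eval_of_map_eq_line hf x).symm ▸ hpos x hx
  simp only [eval_of_map_eq_line hf, eval_of_map_eq_line hg,
    eval_of_map_eq_line (derivative_map_eq_line hf),
    eval_of_map_eq_line (derivative_map_eq_line hg), Complex.ofReal_one, one_smul,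
    Complex.ofReal_zero, zero_smul, add_zero, sub_zero, one_mul] at h
  exact ⟨h.1, div_nonpos_of_nonpos_of_nonneg h.2.1 (sq_nonneg _), h.2.2⟩

lemma continuous_val (P : MatPoly n) : Continuous (val P) := by
  have : Continuous fun M : Matrix n n ℂ => evalAt M P := by
    simp only [evalAt, MvPolynomial.aeval_eq_eval]
    exact (MvPolynomial.continuous_eval P).comp (by fun_prop)
  exact Complex.continuous_re.comp this

/-- Positivity on the translate of the positive semidefinite cone with apex `M`. -/
def ConePos (P : MatPoly n) (M : Matrix n n ℂ) : Prop :=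
  ∀ ⦃T : Matrix n n ℂ⦄, T.PosSemidef → 0 < val P (M + T)

lemma ConePos.add {P : MatPoly n} {M T : Matrix n n ℂ} (h : ConePos P M) (hT : T.PosSemidef) :
    ConePos P (M + T) := fun S hS => by
  rw [add_assoc]
  exact h (hT.add hS)

lemma ConePos.pos {P : MatPoly n} {M : Matrix n n ℂ} (h : ConePos P M) : 0 < val P M := by
  simpa using h Matrix.PosSemidef.zero

lemma val_sub (P Q : MatPoly n) (M : Matrix n n ℂ) : val (P - Q) M = val P M - val Q M := by
  simp [val]

lemma val_dirDeriv_add (A B : Matrix n n ℂ) (P : MatPoly n) (M : Matrix n n ℂ) :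
    val (dirDeriv (A + B) P) M = val (dirDeriv A P) M + val (dirDeriv B P) M := by
  simp [val, dirDeriv_add]

lemma val_dirDeriv_smul (c : ℝ) (A : Matrix n n ℂ) (P : MatPoly n) (M : Matrix n n ℂ) :
    val (dirDeriv ((c : ℂ) • A) P) M = c * val (dirDeriv A P) M := by
  rw [val, dirDeriv_smul, map_smul, smul_eq_mul, Complex.re_ofReal_mul, val]

lemma val_dirDeriv_sum {ι : Type*} (s : Finset ι) (A : ι → Matrix n n ℂ) (P : MatPoly n)
    (M : Matrix n n ℂ) :
    val (dirDeriv (∑ i ∈ s, A i) P) M = ∑ i ∈ s, val (dirDeriv (A i) P) M := by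
  simp [val, dirDeriv_sum]

lemma val_dirDeriv_nonneg_of_posDef {P : MatPoly n} (hP : IsStable P) {M A : Matrix n n ℂ}
    (hM : M.IsHermitian) (hpos : ConePos P M) (hA : A.PosDef) : 0 ≤ val (dirDeriv A P) M := by
  obtain ⟨f, hf⟩ := hP.conj.exists_realLine hM hA.isHermitian
  obtain ⟨g, hg⟩ := (hP.conj.dirDeriv hA.isHermitian).exists_realLine hM hA.isHermitian
  have hs := splits_of_forall_aeval_ne_zero fun z hz =>
    (hP.mapsUpperToLower hM hA hA.posSemidef hf hg z hz).1
  have h0 : 0 < f.eval 0 := by simpa [eval_of_map_eq_line hf] using hpos.pos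
  have h1 := hs.eval_derivative_div_eval_of_ne_zero h0.ne'
  rw [eval_of_map_eq_line (derivative_map_eq_line hf), Complex.ofReal_zero, zero_smul,
    add_zero, div_eq_iff h0.ne'] at h1
  rw [h1]
  refine mul_nonneg (Multiset.sum_nonneg fun x hx => ?_) h0.le
  obtain ⟨r, hr, rfl⟩ := Multiset.mem_map.1 hx
  have hr0 : r < 0 := by
    by_contra! hc
    have h2 := hpos (posSemidef_smul hA.posSemidef hc)
    rw [← eval_of_map_eq_line hf, (mem_roots'.1 hr).2] at h2
    exact h2.false
  exact one_div_nonneg.2 (by linarith)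

variable [DecidableEq n]

lemma posDef_add_smul_one {B : Matrix n n ℂ} (hB : B.PosSemidef) {κ : ℝ} (hκ : 0 < κ) :
    (B + (κ : ℂ) • 1).PosDef :=
  Matrix.PosDef.posSemidef_add hB (Matrix.PosDef.one.smul (by exact_mod_cast hκ))

lemma le_of_forall_pos_le {f : ℝ → ℝ} {c : ℝ} (hf : ContinuousAt f 0) (h : ∀ κ, 0 < κ → f κ ≤ c) :
    f 0 ≤ c :=
  le_of_tendsto (hf.tendsto.mono_left (nhdsWithin_le_nhds (s := Set.Ioi 0)))
    (eventually_nhdsWithin_of_forall h)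

lemma continuous_val_add_smul_one (P : MatPoly n) (M : Matrix n n ℂ) :
    Continuous fun κ : ℝ => val P (M + (κ : ℂ) • 1) :=
  (continuous_val P).comp (by fun_prop)

lemma IsStable.barrier_posSemidef {P : MatPoly n} (hP : IsStable P) {H B A : Matrix n n ℂ}
    (hH : H.IsHermitian) (hpos : ConePos P H) (hB : B.PosSemidef) (hA : A.PosSemidef) :
    barrier A P (H + B) ≤ barrier A P H ∧ barrierSlope A B P (H + B) ≤ 0 ∧
      barrier A P (H + B) - barrierSlope A B P (H + B) ≤ barrier A P H := by
  have key : ∀ κ : ℝ, 0 < κ → _ := fun κ hκ =>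
    hP.barrier_posDef hH (posDef_add_smul_one hB hκ) hA fun x hx =>
      hpos (posSemidef_smul (posDef_add_smul_one hB hκ).posSemidef hx)
  have h0 : val P (H + B + ((0 : ℝ) : ℂ) • 1) ≠ 0 := by simpa using (hpos hB).ne'
  have c1 : ContinuousAt (fun κ : ℝ => barrier A P (H + (B + (κ : ℂ) • 1))) 0 := by
    simp only [← add_assoc, barrier]
    exact (continuous_val_add_smul_one _ _).continuousAt.div
      (continuous_val_add_smul_one _ _).continuousAt h0
  have c2 : ContinuousAt
      (fun κ : ℝ => barrierSlope A (B + (κ : ℂ) • 1) P (H + (B + (κ : ℂ) • 1))) 0 := by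
    simp only [← add_assoc, barrierSlope, val_dirDeriv_add, val_dirDeriv_smul]
    have hc := fun Q => (continuous_val_add_smul_one Q (H + B)).continuousAt (x := 0)
    have hi : ContinuousAt (fun κ : ℝ => κ) 0 := continuousAt_id
    exact ((((hc _).add (hi.mul (hc _))).mul (hc _)).sub
      ((hc _).mul ((hc _).add (hi.mul (hc _))))).div ((hc _).pow 2) (pow_ne_zero 2 h0)
  have k1 := le_of_forall_pos_le c1 fun κ hκ => (key κ hκ).1
  have k2 := le_of_forall_pos_le c2 fun κ hκ => (key κ hκ).2.1
  have k3 := le_of_forall_pos_le (c1.sub c2) fun κ hκ => (key κ hκ).2.2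
  simp only [Pi.sub_apply, Complex.ofReal_zero, zero_smul, add_zero] at k1 k2 k3
  exact ⟨k1, k2, k3⟩

lemma IsStable.val_dirDeriv_nonneg {P : MatPoly n} (hP : IsStable P) {M A : Matrix n n ℂ}
    (hM : M.IsHermitian) (hpos : ConePos P M) (hA : A.PosSemidef) :
    0 ≤ val (dirDeriv A P) M := by
  have h : ∀ κ : ℝ, 0 < κ → -(val (dirDeriv A P) M + κ * val (dirDeriv 1 P) M) ≤ 0 :=
    fun κ hκ => by
      have := val_dirDeriv_nonneg_of_posDef hP hM hpos (posDef_add_smul_one hA hκ)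
      rw [val_dirDeriv_add, val_dirDeriv_smul] at this
      linarith
  have := le_of_forall_pos_le (f := fun κ => -(val (dirDeriv A P) M + κ * val (dirDeriv 1 P) M))
    (by fun_prop) h
  simpa using this

lemma IsStable.conePos_sub_dirDeriv {P : MatPoly n} (hP : IsStable P) {M A : Matrix n n ℂ}
    (hM : M.IsHermitian) (hpos : ConePos P M) (hA : A.PosSemidef) (hb : barrier A P M < 1) :
    ConePos (P - dirDeriv A P) M := fun T hT => by
  have h := (hP.barrier_posSemidef hM hpos hT hA).1.trans_lt hb
  rw [barrier, div_lt_one (hpos hT)] at h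
  rw [val_sub]
  linarith

lemma IsStable.barrier_sub_dirDeriv_le {P : MatPoly n} (hP : IsStable P) {M A B : Matrix n n ℂ}
    (hM : M.IsHermitian) (hpos : ConePos P M) (hA : A.PosSemidef) (hB : B.PosSemidef)
    {δ : ℝ} (hδ : 0 < δ) (hb : barrier A P M ≤ 1 - 1 / δ) :
    barrier B (P - dirDeriv A P) (M + (δ : ℂ) • A) ≤ barrier B P M := by
  have hδA := posSemidef_smul hA hδ.le
  have h1 := (hP.barrier_posSemidef hM hpos hδA hA).1.trans hb
  obtain ⟨-, h2, h3⟩ := hP.barrier_posSemidef hM hpos hδA hB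
  refine le_trans ?_ h3
  have hp := hpos hδA
  simp only [barrierSlope, barrier, val_sub, map_sub, val_dirDeriv_smul,
    dirDeriv_comm B A] at h1 h2 ⊢
  generalize val P (M + (δ : ℂ) • A) = p at *
  generalize val (dirDeriv A P) (M + (δ : ℂ) • A) = a at *
  generalize val (dirDeriv B P) (M + (δ : ℂ) • A) = b at *
  generalize val (dirDeriv A (dirDeriv B P)) (M + (δ : ℂ) • A) = c at *
  have hpa : p / δ ≤ p - a := by
    rw [div_le_iff₀ hp] at h1
    have : p / δ = 1 / δ * p := by ring
    linarith
  have hpa0 : 0 < p - a := (div_pos hp hδ).trans_le hpa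
  rw [div_le_iff₀ hδ] at hpa
  have hc : δ * c * p - b * (δ * a) ≤ 0 := by
    by_contra! h
    exact h2.not_gt (div_pos h (pow_pos hp 2))
  have hc' : c * p - b * a ≤ 0 := by
    by_contra! h
    nlinarith [mul_pos hδ h]
  have key : b / p - (δ * c * p - b * (δ * a)) / p ^ 2 - (b - c) / (p - a) =
      -(c * p - b * a) * ((p - a) * δ - p) / (p ^ 2 * (p - a)) := by
    field_simp
    ring
  have : 0 ≤ -(c * p - b * a) * ((p - a) * δ - p) / (p ^ 2 * (p - a)) :=
    div_nonneg (mul_nonneg (by linarith) (by linarith)) (by positivity)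
  linarith

lemma IsStable.val_pos_of_sub_dirDeriv {P : MatPoly n} (hP : IsStable P) {N A : Matrix n n ℂ}
    (hN : N.IsHermitian) (hA : A.PosSemidef) {R : ℝ} (hR : ConePos P (N + (R : ℂ) • 1))
    (h : ∀ y : ℝ, 0 ≤ y → 0 < val (P - dirDeriv A P) (N + (y : ℂ) • 1)) {y : ℝ} (hy : 0 ≤ y) :
    0 < val P (N + (y : ℂ) • 1) := by
  by_contra! hc
  have hlarge : ∀ x : ℝ, R ≤ x → ConePos P (N + (x : ℂ) • 1) := fun x hx => by
    have := hR.add (posSemidef_smul .one (sub_nonneg.2 hx))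
    have e : N + (R : ℂ) • 1 + ((x - R : ℝ) : ℂ) • (1 : Matrix n n ℂ) = N + (x : ℂ) • 1 := by
      push_cast
      module
    rwa [e] at this
  have hcont := fun Q => continuous_val_add_smul_one Q N
  let S : Set ℝ := {x | 0 ≤ x ∧ val P (N + (x : ℂ) • 1) ≤ 0}
  have hSclosed : IsClosed S := isClosed_Ici.inter (isClosed_le (hcont P) continuous_const)
  have hSbdd : BddAbove S := ⟨R, fun x hx => by
    by_contra! hRx
    exact (hlarge x hRx.le).pos.not_ge hx.2⟩
  have hr := hSclosed.csSup_mem ⟨y, hy, hc⟩ hSbdd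
  set r := sSup S
  have hpos : ∀ x, r < x → 0 < val P (N + (x : ℂ) • 1) := fun x hx => by
    by_contra! hle
    exact hx.not_ge (le_csSup hSbdd ⟨hr.1.trans hx.le, hle⟩)
  have hD : ∀ x, r < x → 0 ≤ val (dirDeriv A P) (N + (x : ℂ) • 1) := fun x hx => by
    let z := max R x + 1
    have hxz : x < z := lt_add_of_le_of_pos (le_max_right R x) one_pos
    have hRz : R ≤ z := by linarith [le_max_left R x]
    have hB : (((z - x : ℝ) : ℂ) • (1 : Matrix n n ℂ)).PosDef :=
      Matrix.PosDef.one.smul (by exact_mod_cast sub_pos.2 hxz)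
    have hanti := (hP.barrier_posDef (isHermitian_add_smul hN Matrix.isHermitian_one x) hB hA
      fun s hs => by
        have e : N + (x : ℂ) • 1 + (s : ℂ) • ((z - x : ℝ) : ℂ) • (1 : Matrix n n ℂ) =
            N + ((x + s * (z - x) : ℝ) : ℂ) • 1 := by
          push_cast
          module
        rw [e]
        exact hpos _ (by nlinarith)).1
    have e : N + (x : ℂ) • 1 + ((z - x : ℝ) : ℂ) • (1 : Matrix n n ℂ) = N + (z : ℂ) • 1 := by
      push_cast
      module
    rw [e] at hanti
    have hz := hP.val_dirDeriv_nonneg (isHermitian_add_smul hN Matrix.isHermitian_one z)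
      (hlarge z hRz) hA
    have h0 : 0 ≤ barrier A P (N + (x : ℂ) • 1) :=
      (div_nonneg hz (hlarge z hRz).pos.le).trans hanti
    by_contra! hneg
    exact h0.not_gt (div_neg_of_neg_of_pos hneg (hpos x hx))
  have hDr : 0 ≤ val (dirDeriv A P) (N + (r : ℂ) • 1) :=
    ge_of_tendsto ((hcont (dirDeriv A P)).continuousAt.tendsto.mono_left
      (nhdsWithin_le_nhds (s := Set.Ioi r))) (eventually_nhdsWithin_of_forall hD)
  have hq := h r hr.1
  rw [val_sub] at hq
  linarith [hr.2]

lemma isHermitian_smul_one_sub {C : Matrix n n ℂ} (hC : C.IsHermitian) (x : ℝ) :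
    ((x : ℂ) • 1 - C).IsHermitian := by
  simpa [sub_eq_add_neg, add_comm] using isHermitian_add_smul hC.neg Matrix.isHermitian_one x

lemma IsStable.tendsto_barrier_one {P : MatPoly n} (hP : IsStable P) {M : Matrix n n ℂ}
    (hM : M.IsHermitian) (hpos : ConePos P M) :
    Tendsto (fun x : ℝ => barrier 1 P (M + (x : ℂ) • 1)) atTop (𝓝 0) := by
  obtain ⟨f, hf⟩ := hP.conj.exists_realLine hM Matrix.isHermitian_one
  have hf0 : f ≠ 0 := by
    rintro rfl
    have := hpos (posSemidef_smul .one le_rfl)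
    rw [← eval_of_map_eq_line hf, eval_zero] at this
    exact this.false
  have := div_tendsto_atTop_zero_of_degree_lt (derivative f) f (degree_derivative_lt hf0)
  simpa only [eval_of_map_eq_line hf, eval_of_map_eq_line (derivative_map_eq_line hf),
    barrier] using this

variable [Fintype n]

/-- The determinant, as a polynomial in the matrix entries. -/
noncomputable def detPoly (n : Type*) [Fintype n] [DecidableEq n] : MatPoly n :=
  (Matrix.mvPolynomialX n n ℂ).det

lemma evalAt_detPoly (M : Matrix n n ℂ) : evalAt M (detPoly n) = M.det := by
  rw [evalAt, MvPolynomial.aeval_eq_eval, detPoly, Matrix.eval_det_mvPolynomialX]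
  rfl

lemma isStable_detPoly : IsStable (detPoly n) where
  conj M := by
    rw [evalAt_detPoly, evalAt_detPoly, Matrix.det_conjTranspose]
    rfl
  ne_zero {H B} hH hB h0 := by
    rw [evalAt_detPoly, ← Matrix.exists_mulVec_eq_zero_iff] at h0
    obtain ⟨u, hu, h⟩ := h0
    rw [Matrix.add_mulVec, Matrix.smul_mulVec] at h
    have h1 := congrArg (fun w => (star u ⬝ᵥ w).im) h
    simp only [dotProduct_add, dotProduct_smul, dotProduct_zero, Complex.add_im,
      Complex.zero_im, smul_eq_mul, Complex.I_mul_im] at h1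
    have h2 : (star u ⬝ᵥ H.mulVec u).im = 0 := hH.im_star_dotProduct_mulVec_self u
    have h3 := (Complex.pos_iff.1 (hB.dotProduct_mulVec_pos hu)).1
    rw [h2, zero_add] at h1
    exact h3.ne' h1

lemma conePos_detPoly {M : Matrix n n ℂ} (hM : M.PosDef) : ConePos (detPoly n) M :=
  fun T hT => by
    rw [val, evalAt_detPoly]
    exact (Complex.pos_iff.1 (hM.add_posSemidef hT).det_pos).1

open scoped Matrix.Norms.L2Operator MatrixOrder in
lemma exists_smul_one_sub_posSemidef {C : Matrix n n ℂ} (hC : C.IsHermitian) :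
    ∃ c : ℝ, 0 ≤ c ∧ ((c : ℂ) • 1 - C).PosSemidef := by
  refine ⟨‖C‖, norm_nonneg _, ?_⟩
  have h := IsSelfAdjoint.le_algebraMap_norm_self (a := C) hC
  rw [Matrix.le_iff, Algebra.algebraMap_eq_smul_one] at h
  exact h

lemma posSemidef_of_val_detPoly_pos {N : Matrix n n ℂ} (hN : N.IsHermitian)
    (h : ∀ y : ℝ, 0 ≤ y → 0 < val (detPoly n) (N + (y : ℂ) • 1)) : N.PosSemidef := by
  rw [hN.posSemidef_iff_eigenvalues_nonneg]
  intro i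
  by_contra! hi
  have h1 := h (-hN.eigenvalues i) (neg_nonneg.2 hi.le)
  have h2 : (N + ((-hN.eigenvalues i : ℝ) : ℂ) • (1 : Matrix n n ℂ)).det = 0 := by
    rw [← Matrix.exists_mulVec_eq_zero_iff]
    refine ⟨hN.eigenvectorBasis i, fun h0 => hN.eigenvectorBasis.orthonormal.ne_zero i ?_, ?_⟩
    · ext a
      exact congrFun h0 a
    · rw [Matrix.add_mulVec, hN.mulVec_eigenvectorBasis, Matrix.smul_mulVec, Matrix.one_mulVec]
      ext a
      simp
  rw [val, evalAt_detPoly, h2] at h1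
  exact lt_irrefl _ h1

lemma IsStable.exists_conePos_sub_dirDeriv {P : MatPoly n} (hP : IsStable P) {M A : Matrix n n ℂ}
    (hM : M.IsHermitian) (hpos : ConePos P M) (hA : A.PosSemidef) :
    ∃ R : ℝ, 0 ≤ R ∧ ConePos (P - dirDeriv A P) (M + (R : ℂ) • 1) := by
  obtain ⟨c, hc0, hc⟩ := exists_smul_one_sub_posSemidef hA.isHermitian
  have ht := (hP.tendsto_barrier_one hM hpos).const_mul c
  rw [mul_zero] at ht
  obtain ⟨R, hR, hR0⟩ := ((ht.eventually_lt_const one_pos).and (eventually_ge_atTop 0)).exists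
  have hpsd := posSemidef_smul (Matrix.PosSemidef.one (n := n) (R := ℂ)) hR0
  have hM' := isHermitian_add_smul hM Matrix.isHermitian_one R
  have hpos' := hpos.add hpsd
  refine ⟨R, hR0, fun T hT => ?_⟩
  have h1 := (hP.barrier_posSemidef hM' hpos' hT hA).1
  have h2 : barrier A P (M + (R : ℂ) • 1) ≤ c * barrier 1 P (M + (R : ℂ) • 1) := by
    have h3 := hP.val_dirDeriv_nonneg hM' hpos' hc
    have h4 := val_dirDeriv_add ((c : ℂ) • 1 - A) A P (M + (R : ℂ) • 1)
    rw [sub_add_cancel, val_dirDeriv_smul] at h4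
    rw [barrier, barrier, ← mul_div_assoc]
    exact div_le_div_of_nonneg_right (by linarith) hpos'.pos.le
  have h5 : barrier A P (M + (R : ℂ) • 1 + T) < 1 := by linarith
  rw [barrier, div_lt_one (hpos' hT)] at h5
  rw [val_sub]
  linarith

/-- The polynomial `∏ (1 - ∂_A) det` over the matrices `A` in a list. Its value at `x • 1` is the
mixed characteristic polynomial of the list. -/
noncomputable def mixedPoly : List (Matrix n n ℂ) → MatPoly n
  | [] => detPoly n
  | A :: L => mixedPoly L - dirDeriv A (mixedPoly L)

lemma isStable_mixedPoly {L : List (Matrix n n ℂ)} (hL : ∀ A ∈ L, A.PosSemidef) :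
    IsStable (mixedPoly L) := by
  induction L with
  | nil => exact isStable_detPoly
  | cons A L ih =>
    exact (ih fun B hB => hL B (List.mem_cons_of_mem A hB)).sub_dirDeriv (hL A List.mem_cons_self)

lemma exists_conePos_mixedPoly {L : List (Matrix n n ℂ)} (hL : ∀ A ∈ L, A.PosSemidef)
    {C : Matrix n n ℂ} (hC : C.IsHermitian) :
    ∃ R : ℝ, ConePos (mixedPoly L) ((R : ℂ) • 1 - C) := by
  induction L with
  | nil =>
    obtain ⟨c, -, hc⟩ := exists_smul_one_sub_posSemidef hC
    refine ⟨c + 1, conePos_detPoly ?_⟩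
    have := posDef_add_smul_one hc one_pos
    convert this using 1
    push_cast
    module
  | cons A L ih =>
    have hL' := fun B hB => hL B (List.mem_cons_of_mem A hB)
    obtain ⟨R, hR⟩ := ih hL'
    obtain ⟨S, -, hS⟩ := (isStable_mixedPoly hL').exists_conePos_sub_dirDeriv
      (isHermitian_smul_one_sub hC R) hR (hL A List.mem_cons_self)
    refine ⟨R + S, ?_⟩
    have : ((R + S : ℝ) : ℂ) • 1 - C = (R : ℂ) • 1 - C + (S : ℂ) • 1 := by
      push_cast
      module
    rw [this]
    exact hS

lemma eval_neg_one_of_derivative_derivative_eq_zero {f : ℂ[X]}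
    (hf : derivative (derivative f) = 0) :
    f.eval (-1) = f.eval 0 - (derivative f).eval 0 := by
  obtain ⟨c, hc⟩ := natDegree_eq_zero.1 (derivative_eq_zero.1 hf)
  have h : derivative (f - C c * X) = 0 := by
    rw [derivative_sub, derivative_C_mul, derivative_X, mul_one, hc, sub_self]
  obtain ⟨d, hd⟩ := natDegree_eq_zero.1 (derivative_eq_zero.1 h)
  rw [← hc, eq_add_of_sub_eq hd.symm]
  simp
  ring

lemma dirDeriv_dirDeriv_detPoly (u v : n → ℂ) :
    dirDeriv (Matrix.vecMulVec u v) (dirDeriv (Matrix.vecMulVec u v) (detPoly n)) = 0 := by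
  refine MvPolynomial.eq_of_eval_eq_on_gl fun g => ?_
  have hu : IsUnit (g : Matrix n n ℂ).det := (Matrix.isUnit_iff_isUnit_det _).1 g.isUnit
  have h : ∃ b : ℂ, line g (Matrix.vecMulVec u v) (detPoly n) =
      C (g : Matrix n n ℂ).det * (1 + X * C b) := by
    refine ⟨(Matrix.replicateRow Unit v * (g : Matrix n n ℂ)⁻¹ *
      Matrix.replicateCol Unit u) () (), Polynomial.funext fun z => ?_⟩
    rw [eval_line, evalAt_detPoly, ← Matrix.smul_vecMulVec,
      Matrix.vecMulVec_eq Unit, Matrix.det_add_replicateCol_mul_replicateRow hu]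
    simp
    exact Or.inl (mul_comm _ _)
  obtain ⟨b, hb⟩ := h
  have := eval_line g (Matrix.vecMulVec u v) 
    (dirDeriv (Matrix.vecMulVec u v) (dirDeriv (Matrix.vecMulVec u v) (detPoly n))) 0
  rw [← derivative_line, ← derivative_line, hb, zero_smul, add_zero] at this
  rw [map_zero]
  refine this.symm.trans ?_
  simp

lemma dirDeriv_dirDeriv_mixedPoly (u v : n → ℂ) (L : List (Matrix n n ℂ)) :
    dirDeriv (Matrix.vecMulVec u v) (dirDeriv (Matrix.vecMulVec u v) (mixedPoly L)) = 0 := by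
  induction L with
  | nil => exact dirDeriv_dirDeriv_detPoly u v
  | cons A L ih =>
    rw [mixedPoly, map_sub, map_sub, ih, dirDeriv_comm _ A, dirDeriv_comm _ A, ih, map_zero,
      sub_zero]

lemma val_mixedPoly_sub_vecMulVec (u v : n → ℂ) (L : List (Matrix n n ℂ)) (M : Matrix n n ℂ) :
    val (mixedPoly L) (M - Matrix.vecMulVec u v) =
      val (mixedPoly L) M - val (dirDeriv (Matrix.vecMulVec u v) (mixedPoly L)) M := by
  have h := eval_neg_one_of_derivative_derivative_eq_zero
    (f := line M (Matrix.vecMulVec u v) (mixedPoly L))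
    (by rw [derivative_line, derivative_line, dirDeriv_dirDeriv_mixedPoly, map_zero])
  rw [derivative_line, eval_line, eval_line, eval_line, neg_one_smul, zero_smul, add_zero,
    ← sub_eq_add_neg] at h
  rw [val, h, Complex.sub_re, val, val]

lemma conePos_mixedPoly_add_smul_sum {M : Matrix n n ℂ} (hM : M.PosDef) {δ : ℝ} (hδ : 0 < δ)
    {L : List (Matrix n n ℂ)} (hL : ∀ A ∈ L, A.PosSemidef)
    (hb : ∀ A ∈ L, barrier A (detPoly n) M ≤ 1 - 1 / δ) :
    ConePos (mixedPoly L) (M + (δ : ℂ) • L.sum) ∧ ∀ B : Matrix n n ℂ, B.PosSemidef →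
      barrier B (mixedPoly L) (M + (δ : ℂ) • L.sum) ≤ barrier B (detPoly n) M := by
  induction L with
  | nil => simpa [mixedPoly] using conePos_detPoly hM
  | cons A L ih =>
    simp only [List.forall_mem_cons] at hL hb
    obtain ⟨h1, h2⟩ := ih hL.2 hb.2
    have hs := isStable_mixedPoly hL.2
    have hH : (M + (δ : ℂ) • L.sum).IsHermitian :=
      isHermitian_add_smul hM.isHermitian
        (List.sum_induction Matrix.IsHermitian (fun _ _ => Matrix.IsHermitian.add)
          Matrix.isHermitian_zero fun A hA => (hL.2 A hA).isHermitian) δ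
    have hA := (h2 A hL.1).trans hb.1
    have e : M + (δ : ℂ) • (A :: L).sum = M + (δ : ℂ) • L.sum + (δ : ℂ) • A := by
      rw [List.sum_cons]
      module
    rw [e, mixedPoly]
    refine ⟨(hs.conePos_sub_dirDeriv hH h1 hL.1 (hA.trans_lt ?_)).add
      (posSemidef_smul hL.1 hδ.le), fun B hB => ?_⟩
    · linarith [one_div_pos.2 hδ]
    · exact (hs.barrier_sub_dirDeriv_le hH h1 hL.1 hB hδ hA).trans (h2 B hB)

lemma barrier_detPoly_smul_one (A : Matrix n n ℂ) {t : ℝ} (ht : 0 < t) :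
    barrier A (detPoly n) ((t : ℂ) • 1) = A.trace.re / t := by
  have ht' : (t : ℂ) ≠ 0 := by exact_mod_cast ht.ne'
  have h : line ((t : ℂ) • 1) A (detPoly n) = C ((t : ℂ) ^ Fintype.card n) *
      (Matrix.det (1 + (X : ℂ[X]) • A.map C)).comp (C (t : ℂ)⁻¹ * X) := by
    refine Polynomial.funext fun z => ?_
    have e : (t : ℂ) • (1 : Matrix n n ℂ) + z • A = (t : ℂ) • (1 + ((t : ℂ)⁻¹ * z) • A) := by
      rw [smul_add, smul_smul, mul_inv_cancel_left₀ ht']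
    rw [eval_line, evalAt_detPoly, e, Matrix.det_smul, eval_mul, eval_C, eval_comp]
    congr 1
    rw [← coe_evalRingHom, RingHom.map_det]
    congr 1
    ext i j
    by_cases hij : i = j <;> simp [hij] <;> ring
  have h1 : evalAt ((t : ℂ) • 1) (dirDeriv A (detPoly n)) =
      (t : ℂ) ^ Fintype.card n * (A.trace / t) := by
    rw [evalAt_dirDeriv, h, derivative_C_mul, derivative_comp]
    simp [eval_comp, Matrix.derivative_det_one_add_X_smul]
    exact Or.inl (by ring)
  have h2 : evalAt ((t : ℂ) • 1) (detPoly n) = (t : ℂ) ^ Fintype.card n := by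
    rw [evalAt_detPoly, Matrix.det_smul, Matrix.det_one, mul_one]
  rw [barrier, val, val, h1, h2, ← Complex.ofReal_pow, Complex.re_ofReal_mul, Complex.ofReal_re,
    Complex.div_ofReal_re, mul_div_cancel_left₀ _ (pow_pos ht _).ne']

lemma exists_val_mixedPoly_pos {ι : Type*} [Fintype ι] {p : ι → ℝ} (hp0 : ∀ j, 0 ≤ p j)
    (hp1 : ∑ j, p j = 1) (v : ι → n → ℂ) {L : List (Matrix n n ℂ)}
    (hL : ∀ A ∈ L, A.PosSemidef) {N : Matrix n n ℂ} (hN : N.IsHermitian)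
    (h : ∀ y : ℝ, 0 ≤ y → 0 < val
      (mixedPoly ((∑ j, (p j : ℂ) • Matrix.vecMulVec (v j) (star (v j))) :: L))
        (N + (y : ℂ) • 1)) :
    ∃ j, ∀ y : ℝ, 0 ≤ y →
      0 < val (mixedPoly L) (N - Matrix.vecMulVec (v j) (star (v j)) + (y : ℂ) • 1) := by
  have hV : ∀ j, (Matrix.vecMulVec (v j) (star (v j))).PosSemidef :=
    fun j => Matrix.posSemidef_vecMulVec_self_star (v j)
  have hA : (∑ j, (p j : ℂ) • Matrix.vecMulVec (v j) (star (v j))).PosSemidef :=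
    Matrix.posSemidef_sum _ fun j _ => posSemidef_smul (hV j) (hp0 j)
  have hP := isStable_mixedPoly hL
  obtain ⟨R, hR⟩ := exists_conePos_mixedPoly hL hN.neg
  rw [sub_neg_eq_add, add_comm] at hR
  have hpos := fun y hy => hP.val_pos_of_sub_dirDeriv hN hA hR h (y := y) hy
  have hpos0 : 0 < val (mixedPoly L) N := by simpa using hpos 0 le_rfl
  obtain ⟨j, hj⟩ : ∃ j, barrier (Matrix.vecMulVec (v j) (star (v j))) (mixedPoly L) N < 1 := by
    by_contra! hc
    have h0 := h 0 le_rfl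
    rw [mixedPoly, val_sub, val_dirDeriv_sum] at h0
    simp only [val_dirDeriv_smul, Complex.ofReal_zero, zero_smul, add_zero] at h0
    have h1 : ∑ j, p j * val (mixedPoly L) N ≤
        ∑ j, p j * val (dirDeriv (Matrix.vecMulVec (v j) (star (v j))) (mixedPoly L)) N :=
      Finset.sum_le_sum fun j _ => mul_le_mul_of_nonneg_left
        ((one_le_div hpos0).1 (hc j)) (hp0 j)
    rw [← Finset.sum_mul, hp1, one_mul] at h1
    linarith
  refine ⟨j, fun y hy => ?_⟩
  have hb : barrier (Matrix.vecMulVec (v j) (star (v j))) (mixedPoly L) (N + (y : ℂ) • 1) < 1 := by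
    rcases hy.eq_or_lt with rfl | hy'
    · simpa using hj
    · refine (hP.barrier_posDef hN (Matrix.PosDef.one.smul (by exact_mod_cast hy')) (hV j)
        fun x hx => ?_).1.trans_lt hj
      have := hpos (x * y) (mul_nonneg hx hy)
      rwa [Complex.ofReal_mul, mul_smul] at this
  rw [barrier, div_lt_one (hpos y hy)] at hb
  rw [sub_add_eq_add_sub, val_mixedPoly_sub_vecMulVec]
  linarith

lemma exists_choice_val_detPoly_pos {ι : Type*} {κ : ι → Type*} [∀ i, Fintype (κ i)]
    {p : ∀ i, κ i → ℝ} (hp0 : ∀ i j, 0 ≤ p i j) (hp1 : ∀ i, ∑ j, p i j = 1)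
    (v : ∀ i, κ i → n → ℂ) {l : List ι} (hl : l.Nodup) {N : Matrix n n ℂ} (hN : N.IsHermitian)
    (h : ∀ y : ℝ, 0 ≤ y → 0 < val (mixedPoly (l.map fun i =>
      ∑ j, (p i j : ℂ) • Matrix.vecMulVec (v i j) (star (v i j)))) (N + (y : ℂ) • 1)) :
    ∃ g : ∀ i, κ i, ∀ y : ℝ, 0 ≤ y → 0 < val (detPoly n)
      (N - (l.map fun i => Matrix.vecMulVec (v i (g i)) (star (v i (g i)))).sum +
        (y : ℂ) • 1) := by
  classical
  induction l generalizing N with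
  | nil =>
    have hne : ∀ i, Nonempty (κ i) := fun i => by
      by_contra! hc
      simpa using hp1 i
    exact ⟨fun i => (hne i).some, by simpa [mixedPoly] using h⟩
  | cons i l ih =>
    rw [List.nodup_cons] at hl
    have hL : ∀ A ∈ l.map fun i => ∑ j, (p i j : ℂ) • Matrix.vecMulVec (v i j) (star (v i j)),
        A.PosSemidef := by
      intro A hA
      obtain ⟨i, -, rfl⟩ := List.mem_map.1 hA
      exact Matrix.posSemidef_sum _ fun j _ =>
        posSemidef_smul (Matrix.posSemidef_vecMulVec_self_star _) (hp0 i j)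
    obtain ⟨j, hj⟩ := exists_val_mixedPoly_pos (hp0 i) (hp1 i) (v i) hL hN h
    obtain ⟨g, hg⟩ := ih hl.2
      (hN.sub (Matrix.posSemidef_vecMulVec_self_star (v i j)).isHermitian) hj
    refine ⟨Function.update g i j, fun y hy => ?_⟩
    have e : l.map (fun a => Matrix.vecMulVec (v a (Function.update g i j a))
        (star (v a (Function.update g i j a)))) =
        l.map fun a => Matrix.vecMulVec (v a (g a)) (star (v a (g a))) :=
      List.map_congr_left fun a ha => by
        rw [Function.update_of_ne (ne_of_mem_of_not_mem ha hl.1)]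
    rw [List.map_cons, List.sum_cons, Function.update_self, e, ← sub_sub]
    exact hg y hy

end KadisonSinger

theorem exists_good_assignment {m n : ℕ} (k : Fin m → ℕ)
    (w : (i : Fin m) → Fin (k i) → Fin n → ℂ)
    (p : (i : Fin m) → Fin (k i) → ℝ)
    (hp0 : ∀ i j, 0 ≤ p i j) (hp1 : ∀ i, ∑ j, p i j = 1)
    (ε : ℝ)
    (hsum : ∑ i, ∑ j, ((p i j : ℝ) : ℂ) • Matrix.vecMulVec (w i j) (star (w i j)) = 1)
    (hnorm : ∀ i, ∑ j, p i j * (∑ a, Complex.normSq (w i j a)) ≤ ε) :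
    ∃ g : (i : Fin m) → Fin (k i),
      ((((1 + Real.sqrt ε) ^ 2 : ℝ) : ℂ) • (1 : Matrix (Fin n) (Fin n) ℂ)
        - ∑ i, Matrix.vecMulVec (w i (g i)) (star (w i (g i)))).PosSemidef := by
  let A : Fin m → Matrix (Fin n) (Fin n) ℂ := fun i =>
    ∑ j, (p i j : ℂ) • Matrix.vecMulVec (w i j) (star (w i j))
  have htr : ∀ i, (A i).trace.re ≤ ε := fun i => by
    refine le_of_eq_of_le ?_ (hnorm i)
    simp [A, Matrix.trace_sum, Matrix.trace_smul, Matrix.trace_vecMulVec, dotProduct,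
      Complex.mul_conj, ← Complex.ofReal_sum]
  rcases n.eq_zero_or_pos with rfl | hn
  · have hne : ∀ i, Nonempty (Fin (k i)) := fun i => by
      by_contra! hc
      simpa using hp1 i
    refine ⟨fun i => (hne i).some, ?_⟩
    rw [Subsingleton.elim (_ - _) (0 : Matrix (Fin 0) (Fin 0) ℂ)]
    exact .zero
  have hε : 0 < ε := by
    by_contra! hε
    have h1 : (∑ i, A i).trace.re = n := by
      rw [show ∑ i, A i = 1 from hsum, Matrix.trace_one]
      simp
    rw [Matrix.trace_sum, Complex.re_sum] at h1
    have h2 := Finset.sum_nonpos fun i (_ : i ∈ Finset.univ) => (htr i).trans hε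
    rw [h1] at h2
    exact h2.not_gt (by exact_mod_cast hn)
  have hs := Real.sqrt_pos.2 hε
  have hss := Real.sq_sqrt hε.le
  set s := Real.sqrt ε
  have hA : ∀ B ∈ (List.finRange m).map A, B.PosSemidef := by
    intro B hB
    obtain ⟨i, -, rfl⟩ := List.mem_map.1 hB
    exact Matrix.posSemidef_sum _ fun j _ =>
      KadisonSinger.posSemidef_smul (Matrix.posSemidef_vecMulVec_self_star _) (hp0 i j)
  have ht : 0 < s * (1 + s) := by positivity
  have hcone := (KadisonSinger.conePos_mixedPoly_add_smul_sum
    (M := ((s * (1 + s) : ℝ) : ℂ) • 1) (Matrix.PosDef.one.smul (by exact_mod_cast ht))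
    (δ := 1 + s) (by positivity) hA fun B hB => by
      obtain ⟨i, -, rfl⟩ := List.mem_map.1 hB
      rw [KadisonSinger.barrier_detPoly_smul_one _ ht, div_le_iff₀ ht]
      refine (htr i).trans_eq ?_
      rw [← hss]
      field_simp
      ring).1
  have hlam : ((s * (1 + s) : ℝ) : ℂ) • (1 : Matrix (Fin n) (Fin n) ℂ) +
      ((1 + s : ℝ) : ℂ) • ((List.finRange m).map A).sum = (((1 + s) ^ 2 : ℝ) : ℂ) • 1 := by
    rw [← Fin.sum_univ_def, show ∑ i, A i = 1 from hsum]
    push_cast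
    module
  rw [hlam] at hcone
  have hH : ((((1 + s) ^ 2 : ℝ) : ℂ) • (1 : Matrix (Fin n) (Fin n) ℂ)).IsHermitian :=
    (KadisonSinger.posSemidef_smul .one (by positivity)).isHermitian
  obtain ⟨g, hg⟩ := KadisonSinger.exists_choice_val_detPoly_pos hp0 hp1 w
    (List.nodup_finRange m) hH fun y hy => hcone (KadisonSinger.posSemidef_smul .one hy)
  refine ⟨g, ?_⟩
  rw [← Fin.sum_univ_def] at hg
  exact KadisonSinger.posSemidef_of_val_detPoly_pos
    (hH.sub (Matrix.posSemidef_sum _ fun i _ =>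
      Matrix.posSemidef_vecMulVec_self_star _).isHermitian) hg
end

section
/- Let p be real stable and let z be above its roots, and suppose Φ^i_p(z) < 1 for all i. Then applying the operators (1 - ∂_{z_1}),...,(1 - ∂_{z_m}) successively, with the vector shifted by δ = 1/(1 - max_i Φ^i_p(z)) in the corresponding coordinate at each step, yields by induction: for every k, the vector x^k (equal to z + δ in the first k coordinates and z elsewhere) is above the roots of P_k = (∏_{i=1}^k (1-∂_{z_i})) p, and Φ^i_{P_k}(x^k) ≤ max_j Φ^j_p(z) for all i. -/
open MvPolynomial

/-- Successively apply the operators (1 - ∂_{z_0}), ..., (1 - ∂_{z_{k-1}}). -/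
noncomputable def applyOpsR {m : ℕ} (p : MvPolynomial (Fin m) ℝ) : ℕ → MvPolynomial (Fin m) ℝ
  | 0 => p
  | k + 1 => if h : k < m then applyOpsR p k - pderiv (⟨k, h⟩ : Fin m) (applyOpsR p k)
             else applyOpsR p k

open scoped ComplexConjugate

lemma nonpos_at_zero_of_continuous {f : ℝ → ℝ} (hf : Continuous f) (h : ∀ ε, 0 < ε → f ε ≤ 0) :
    f 0 ≤ 0 :=
  le_of_tendsto (hf.continuousWithinAt (s := Set.Ioi 0) (x := 0))
    (Filter.eventually_of_mem self_mem_nhdsWithin h)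

lemma exists_pow_eq_I_and_neg_I {k : ℕ} (hk : 2 ≤ k) :
    (∃ ω : ℂ, 0 < ω.im ∧ ω ^ k = Complex.I) ∧ ∃ ω : ℂ, 0 < ω.im ∧ ω ^ k = -Complex.I := by
  have hk' : (2 : ℝ) ≤ k := by exact_mod_cast hk
  have hk0 : (k : ℂ) ≠ 0 := by exact_mod_cast (by omega : k ≠ 0)
  have im_pos : ∀ θ : ℝ, 0 < θ → θ < Real.pi → 0 < (Complex.exp (θ * Complex.I)).im := by
    intro θ h0 h1
    rw [Complex.exp_ofReal_mul_I_im]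
    exact Real.sin_pos_of_pos_of_lt_pi h0 h1
  have hpi := Real.pi_pos
  refine ⟨⟨Complex.exp ((Real.pi / (2 * k) : ℝ) * Complex.I), im_pos _ (by positivity) ?_, ?_⟩,
    ⟨Complex.exp ((3 * Real.pi / (2 * k) : ℝ) * Complex.I), im_pos _ (by positivity) ?_, ?_⟩⟩
  · rw [div_lt_iff₀ (by positivity)]
    nlinarith
  · rw [← Complex.exp_nat_mul, show (k : ℂ) * (((Real.pi / (2 * k) : ℝ) : ℂ) * Complex.I)
      = Real.pi / 2 * Complex.I by push_cast; field_simp, Complex.exp_pi_div_two_mul_I]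
  · rw [div_lt_iff₀ (by positivity)]
    nlinarith
  · rw [← Complex.exp_nat_mul, show (k : ℂ) * (((3 * Real.pi / (2 * k) : ℝ) : ℂ) * Complex.I)
      = Real.pi * Complex.I + Real.pi / 2 * Complex.I by push_cast; field_simp; ring,
      Complex.exp_add, Complex.exp_pi_mul_I, Complex.exp_pi_div_two_mul_I]
    ring

namespace Polynomial

/-- The quotient `A / B` maps the open upper half plane to the closed lower half plane
(in a form that makes sense at the zeros of `B`). -/
def MapsToLowerHalfPlane (A B : ℝ[X]) : Prop :=
  ∀ s : ℂ, 0 < s.im → (aeval s A * conj (aeval s B)).im ≤ 0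

namespace MapsToLowerHalfPlane

variable {A B : ℝ[X]}

lemma wronskian_nonpos (h : MapsToLowerHalfPlane A B) (x : ℝ) :
    A.derivative.eval x * B.eval x - A.eval x * B.derivative.eval x ≤ 0 := by
  have expand : ∀ P : ℝ[X], ∃ Q : ℝ[X], P = C (P.eval x) + (X - C x) * Q := fun P => by
    obtain ⟨Q, hQ⟩ := X_sub_C_dvd_sub_C_eval (a := x) (p := P)
    exact ⟨Q, by rw [← hQ]; ring⟩
  have eval_deriv : ∀ P Q : ℝ[X], P = C (P.eval x) + (X - C x) * Q →
      P.derivative.eval x = Q.eval x := by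
    intro P Q hPQ
    rw [hPQ]
    simp
  obtain ⟨A₁, hA⟩ := expand A
  obtain ⟨B₁, hB⟩ := expand B
  rw [eval_deriv A A₁ hA, eval_deriv B B₁ hB]
  set a := A.eval x
  set b := B.eval x
  let f : ℝ → ℝ := fun ε => (aeval ((x : ℂ) + ε * Complex.I) A₁).re * b
    - a * (aeval ((x : ℂ) + ε * Complex.I) B₁).re
    + ε * (aeval ((x : ℂ) + ε * Complex.I) A₁ * conj (aeval ((x : ℂ) + ε * Complex.I) B₁)).im
  have hf : Continuous f := by
    have cont : ∀ P : ℝ[X], Continuous fun ε : ℝ => aeval ((x : ℂ) + ε * Complex.I) P := fun P =>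
      P.continuous_aeval.comp (by fun_prop)
    have hA₁ := cont A₁
    have hB₁ := cont B₁
    fun_prop
  have hf0 : f 0 ≤ 0 := by
    refine nonpos_at_zero_of_continuous hf fun ε hε => ?_
    have key := h ((x : ℂ) + ε * Complex.I) (by simpa using hε)
    rw [hA, hB] at key
    refine nonpos_of_mul_nonpos_right (a := ε) ?_ hε
    refine le_of_eq_of_le ?_ key
    simp only [f, map_add, map_mul, map_sub, aeval_C, aeval_X, Complex.coe_algebraMap,
      Complex.add_re, Complex.add_im, Complex.mul_re, Complex.mul_im, Complex.conj_re,
      Complex.conj_im, Complex.sub_re, Complex.sub_im, Complex.ofReal_re, Complex.ofReal_im,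
      Complex.I_re, Complex.I_im]
    ring
  have real_aeval : ∀ P : ℝ[X], aeval (x : ℂ) P = ((P.eval x : ℝ) : ℂ) := fun P => by
    rw [← Complex.coe_algebraMap, aeval_algebraMap_apply, coe_aeval_eq_eval]
  simpa [f, real_aeval] using hf0

/-- A multiple root of the denominator is a root of the numerator. -/
lemma isRoot_of_pow_dvd {r : ℝ} {k : ℕ} {Q : ℝ[X]}
    (h : MapsToLowerHalfPlane A ((X - C r) ^ k * Q)) (hk : 2 ≤ k) (hQ : Q.eval r ≠ 0) :
    A.eval r = 0 := by
  have key : ∀ ω : ℂ, 0 < ω.im → A.eval r * Q.eval r * (conj (ω ^ k)).im ≤ 0 := by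
    intro ω hω
    let f : ℝ → ℝ := fun ε =>
      (aeval ((r : ℂ) + ε * ω) A * conj (ω ^ k * aeval ((r : ℂ) + ε * ω) Q)).im
    have hf : Continuous f := by
      have cont : ∀ P : ℝ[X], Continuous fun ε : ℝ => aeval ((r : ℂ) + ε * ω) P := fun P =>
        P.continuous_aeval.comp (by fun_prop)
      have hA := cont A
      have hQ := cont Q
      fun_prop
    have hf0 : f 0 ≤ 0 := by
      refine nonpos_at_zero_of_continuous hf fun ε hε => ?_
      have key := h ((r : ℂ) + ε * ω) (by simpa using mul_pos hε hω)
      refine nonpos_of_mul_nonpos_right (a := ε ^ k) ?_ (by positivity)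
      refine le_of_eq_of_le ?_ key
      rw [← Complex.im_ofReal_mul]
      congr 1
      simp only [map_mul, map_pow, map_sub, aeval_C, aeval_X, Complex.coe_algebraMap,
        add_sub_cancel_left, Complex.conj_ofReal, Complex.ofReal_pow]
      ring
    have real_aeval : ∀ P : ℝ[X], aeval (r : ℂ) P = ((P.eval r : ℝ) : ℂ) := fun P => by
      rw [← Complex.coe_algebraMap, aeval_algebraMap_apply, coe_aeval_eq_eval]
    refine le_of_eq_of_le ?_ hf0
    simp only [f, Complex.ofReal_zero, zero_mul, add_zero, real_aeval, map_mul, Complex.conj_ofReal,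
      Complex.im_ofReal_mul, Complex.im_mul_ofReal]
    ring
  obtain ⟨⟨ω, hω, hωk⟩, ⟨ν, hν, hνk⟩⟩ := exists_pow_eq_I_and_neg_I hk
  have h₁ := key ω hω
  have h₂ := key ν hν
  rw [hωk] at h₁
  rw [hνk] at h₂
  simp only [map_neg, Complex.conj_I, Complex.neg_im, Complex.I_im] at h₁ h₂
  have : A.eval r * Q.eval r = 0 := by linarith
  exact (mul_eq_zero.mp this).resolve_right hQ

lemma of_mul_X_sub_C {r : ℝ} (h : MapsToLowerHalfPlane ((X - C r) * A) ((X - C r) * B)) :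
    MapsToLowerHalfPlane A B := by
  intro s hs
  have hne : s - r ≠ 0 := fun h0 => by
    rw [sub_eq_zero.mp h0] at hs
    simp at hs
  refine nonpos_of_mul_nonpos_right (a := Complex.normSq (s - r)) ?_ (Complex.normSq_pos.mpr hne)
  refine le_of_eq_of_le ?_ (h s hs)
  rw [← Complex.im_ofReal_mul, Complex.normSq_eq_conj_mul_self]
  congr 1
  simp only [map_mul, map_sub, aeval_X, aeval_C, Complex.coe_algebraMap]
  ring

lemma exists_partial_fractions_of_no_common_root (h : MapsToLowerHalfPlane A B) (hB0 : B ≠ 0)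
    (hB : B.Splits) (hdeg : A.degree ≤ B.degree) (hcommon : ∀ r, B.IsRoot r → ¬ A.IsRoot r) :
    ∃ (c : ℝ) (S : Finset ℝ) (w : ℝ → ℝ), (∀ r ∈ S, B.IsRoot r ∧ 0 ≤ w r) ∧
      ∀ x, B.eval x ≠ 0 → A.eval x / B.eval x = c + ∑ r ∈ S, w r / (x - r) := by
  classical
  have hnodup : B.roots.Nodup := by
    rw [Multiset.nodup_iff_count_le_one]
    intro r
    rw [count_roots]
    by_contra! hlt
    obtain ⟨Q, hBQ, hQ⟩ := exists_eq_pow_rootMultiplicity_mul_and_not_dvd B hB0 r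
    have hroot : B.IsRoot r := (rootMultiplicity_pos hB0).mp (by omega)
    refine hcommon r hroot ?_
    rw [hBQ] at h
    exact h.isRoot_of_pow_dvd hlt (fun h0 => hQ (dvd_iff_isRoot.mpr h0))
  set S := B.roots.toFinset
  set b := B.leadingCoeff
  have hb : b ≠ 0 := leadingCoeff_ne_zero.mpr hB0
  have hBnodal : B = C b * Lagrange.nodal S id := by
    conv_lhs => rw [hB.eq_prod_roots]
    rw [Lagrange.nodal_eq, Finset.prod, Multiset.toFinset_val, hnodup.dedup]
    rfl
  have hBdeg : B.degree = S.card := by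
    rw [hBnodal, degree_C_mul hb, Lagrange.degree_nodal]
  obtain ⟨c, hc⟩ : ∃ c : ℝ, (A - C c * B).degree < S.card := by
    rcases hdeg.lt_or_eq with hlt | heq
    · exact ⟨0, by simpa [← hBdeg] using hlt⟩
    · have hA0 : A ≠ 0 := fun h0 => hB0 (by simpa [h0] using heq.symm)
      refine ⟨A.leadingCoeff / b, ?_⟩
      rw [← hBdeg, ← heq]
      have ha : A.leadingCoeff / b ≠ 0 := div_ne_zero (leadingCoeff_ne_zero.mpr hA0) hb
      refine degree_sub_lt_left (by rw [degree_C_mul ha, heq]) hA0 ?_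
      rw [leadingCoeff_mul, leadingCoeff_C, div_mul_cancel₀ _ hb]
  refine ⟨c, S, fun r => A.eval r / B.derivative.eval r, fun r hr => ?_, fun x hx => ?_⟩
  · have hroot : B.IsRoot r := isRoot_of_mem_roots (Multiset.mem_toFinset.mp hr)
    refine ⟨hroot, ?_⟩
    beta_reduce
    have hW := h.wronskian_nonpos r
    rw [hroot.eq_zero] at hW
    rw [div_nonneg_iff, ← mul_nonneg_iff]
    linarith
  · have hxS : ∀ r ∈ S, x ≠ id r := by
      rintro r hr rfl
      exact hx (isRoot_of_mem_roots (Multiset.mem_toFinset.mp hr))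
    have hinterp := congrArg (eval x)
      (Lagrange.eq_interpolate (s := S) (v := id) Function.injective_id.injOn hc)
    rw [Lagrange.eval_interpolate_not_at_node _ hxS] at hinterp
    have hBx : B.eval x = b * (Lagrange.nodal S id).eval x := by
      conv_lhs => rw [hBnodal]
      simp
    have hAx : A.eval x = c * B.eval x + B.eval x * ∑ r ∈ S,
        A.eval r / B.derivative.eval r / (x - r) := by
      have hsum : b * ∑ r ∈ S, A.eval r / B.derivative.eval r / (x - r) =
          ∑ r ∈ S, Lagrange.nodalWeight S id r * (x - id r)⁻¹ * (A - C c * B).eval (id r) := by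
        rw [Finset.mul_sum]
        refine Finset.sum_congr rfl fun r hr => ?_
        have hroot : B.eval r = 0 := isRoot_of_mem_roots (Multiset.mem_toFinset.mp hr)
        have hder : B.derivative.eval r = b * (derivative (Lagrange.nodal S id)).eval r := by
          conv_lhs => rw [hBnodal]
          simp
        rw [Lagrange.nodalWeight_eq_eval_derivative_nodal hr, hder]
        simp only [id, eval_sub, eval_mul, eval_C, hroot, mul_zero, sub_zero]
        rw [div_eq_mul_inv, div_eq_mul_inv, mul_inv]
        field_simp
      rw [← hsum, eval_sub, eval_mul, eval_C] at hinterp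
      linear_combination hinterp - (∑ r ∈ S, A.eval r / B.derivative.eval r / (x - r)) * hBx
    rw [hAx]
    field_simp

lemma exists_partial_fractions (h : MapsToLowerHalfPlane A B) (hB0 : B ≠ 0)
    (hB : B.Splits) (hdeg : A.degree ≤ B.degree) :
    ∃ (c : ℝ) (S : Finset ℝ) (w : ℝ → ℝ), (∀ r ∈ S, B.IsRoot r ∧ 0 ≤ w r) ∧
      ∀ x, B.eval x ≠ 0 → A.eval x / B.eval x = c + ∑ r ∈ S, w r / (x - r) := by
  induction hn : B.natDegree using Nat.strong_induction_on generalizing A B with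
  | h n ih =>
    by_cases hcommon : ∃ r, B.IsRoot r ∧ A.IsRoot r
    · obtain ⟨r, hBr, hAr⟩ := hcommon
      obtain ⟨A, rfl⟩ := dvd_iff_isRoot.mpr hAr
      obtain ⟨B, rfl⟩ := dvd_iff_isRoot.mpr hBr
      have hB0' : B ≠ 0 := right_ne_zero_of_mul hB0
      have hdeg' : A.degree ≤ B.degree := by
        rw [degree_mul, degree_mul, degree_X_sub_C] at hdeg
        exact (WithBot.add_le_add_iff_left (by simp)).mp hdeg
      have hn' : B.natDegree < n := by
        rw [natDegree_mul (X_sub_C_ne_zero r) hB0', natDegree_X_sub_C] at hn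
        omega
      obtain ⟨c, S, w, hS, hfrac⟩ :=
        ih _ hn' h.of_mul_X_sub_C hB0' (hB.of_dvd hB0 (dvd_mul_left _ _)) hdeg' rfl
      refine ⟨c, S, w, fun s hs => ⟨by simp [IsRoot.def, (hS s hs).1.eq_zero], (hS s hs).2⟩,
        fun x hx => ?_⟩
      rw [eval_mul] at hx
      rw [← hfrac x (right_ne_zero_of_mul hx), eval_mul, eval_mul,
        mul_div_mul_left _ _ (left_ne_zero_of_mul hx)]
    · push Not at hcommon
      exact h.exists_partial_fractions_of_no_common_root hB0 hB hdeg hcommon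

lemma div_antitoneOn (h : MapsToLowerHalfPlane A B) (hB : ∀ x, 0 ≤ x → 0 < B.eval x) :
    AntitoneOn (fun x => A.eval x / B.eval x) (Set.Ici 0) := by
  have hderiv : ∀ x, 0 ≤ x → HasDerivAt (fun x => A.eval x / B.eval x)
      ((A.derivative.eval x * B.eval x - A.eval x * B.derivative.eval x) / B.eval x ^ 2) x :=
    fun x hx => (A.hasDerivAt x).div (B.hasDerivAt x) (hB x hx).ne'
  refine antitoneOn_of_deriv_nonpos (convex_Ici 0)
    (fun x hx => (hderiv x hx).continuousAt.continuousWithinAt)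
    (fun x hx => (hderiv x (interior_subset hx)).differentiableAt.differentiableWithinAt)
    fun x hx => ?_
  rw [(hderiv x (interior_subset hx)).deriv]
  exact div_nonpos_of_nonpos_of_nonneg (h.wronskian_nonpos x) (sq_nonneg _)

lemma degree_le (h : MapsToLowerHalfPlane A B) (hB : ∀ x, 0 ≤ x → 0 < B.eval x)
    (hA : ∀ x, 0 ≤ x → 0 ≤ A.eval x) : A.degree ≤ B.degree := by
  by_contra! hlt
  have hB0 : B ≠ 0 := fun h0 => by simpa [h0] using hB 0 le_rfl
  have htop := abs_div_tendsto_atTop_atTop_of_degree_gt A B hlt hB0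
  obtain ⟨x, hx0, hx⟩ := ((Filter.eventually_ge_atTop (0 : ℝ)).and
    (htop.eventually_gt_atTop (A.eval 0 / B.eval 0))).exists
  rw [abs_of_nonneg (div_nonneg (hA x hx0) (hB x hx0).le)] at hx
  exact hx.not_ge (h.div_antitoneOn hB (Set.mem_Ici.mpr le_rfl) hx0 hx0)

/-- The tangent of the convex function `A / B` at `δ` lies below its value at `0`. -/
lemma tangent_le (h : MapsToLowerHalfPlane A B) (hsplits : B.Splits)
    (hB : ∀ x, 0 ≤ x → 0 < B.eval x) (hA : ∀ x, 0 ≤ x → 0 ≤ A.eval x) {δ : ℝ} (hδ : 0 < δ) :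
    A.eval δ / B.eval δ - δ * ((A.derivative.eval δ * B.eval δ - A.eval δ * B.derivative.eval δ)
      / B.eval δ ^ 2) ≤ A.eval 0 / B.eval 0 := by
  have hB0 : B ≠ 0 := fun h0 => by simpa [h0] using hB 0 le_rfl
  obtain ⟨c, S, w, hS, hfrac⟩ := h.exists_partial_fractions hB0 hsplits (h.degree_le hB hA)
  have hneg : ∀ r ∈ S, r < 0 := fun r hr => by
    by_contra! h0
    exact (hB r h0).ne' (hS r hr).1
  have hd₁ : HasDerivAt (fun x => A.eval x / B.eval x)
      ((A.derivative.eval δ * B.eval δ - A.eval δ * B.derivative.eval δ) / B.eval δ ^ 2) δ :=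
    (A.hasDerivAt δ).div (B.hasDerivAt δ) (hB δ hδ.le).ne'
  have hd₂ : HasDerivAt (fun x => c + ∑ r ∈ S, w r / (x - r))
      (∑ r ∈ S, -(w r / (δ - r) ^ 2)) δ := by
    refine (HasDerivAt.fun_sum fun r hr => ?_).const_add c
    have hne : δ - r ≠ 0 := by linarith [hneg r hr]
    have := (((hasDerivAt_id δ).sub_const r).inv hne).const_mul (w r)
    simp only [id] at this
    convert! this using 1
    ring
  have heq : (fun x => A.eval x / B.eval x) =ᶠ[nhds δ] fun x => c + ∑ r ∈ S, w r / (x - r) := by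
    filter_upwards [lt_mem_nhds hδ] with x hx
    exact hfrac x (hB x hx.le).ne'
  rw [hd₁.unique (hd₂.congr_of_eventuallyEq heq), hfrac δ (hB δ hδ.le).ne',
    hfrac 0 (hB 0 le_rfl).ne', Finset.mul_sum, add_sub_assoc, ← Finset.sum_sub_distrib]
  gcongr with r hr
  have hr0 := hneg r hr
  have hw := (hS r hr).2
  have h1 : 0 < δ - r := by linarith
  have h2 : 0 < 0 - r := by linarith
  have key : 1 / (δ - r) + δ / (δ - r) ^ 2 ≤ 1 / (0 - r) := by
    rw [div_add_div _ _ h1.ne' (by positivity), div_le_div_iff₀ (by positivity) h2]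
    nlinarith [mul_pos h1 (mul_pos hδ hδ)]
  calc _ = w r * (1 / (δ - r) + δ / (δ - r) ^ 2) := by ring
    _ ≤ w r * (1 / (0 - r)) := by gcongr
    _ = _ := by ring

end MapsToLowerHalfPlane

end Polynomial

namespace Polynomial

/-- Every root of `q` lies strictly below the real axis. -/
def RootsInLowerHalfPlane (q : ℂ[X]) : Prop :=
  ∀ w : ℂ, 0 ≤ w.im → q.eval w ≠ 0

namespace RootsInLowerHalfPlane

variable {q : ℂ[X]}

lemma im_neg_of_mem_roots (h : RootsInLowerHalfPlane q) {w : ℂ} (hw : w ∈ q.roots) : w.im < 0 := by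
  by_contra! h0
  exact h w h0 (isRoot_of_mem_roots hw)

lemma logDeriv_eq_zero_or_im_neg (h : RootsInLowerHalfPlane q) :
    q.derivative.eval 0 / q.eval 0 = 0 ∨ (q.derivative.eval 0 / q.eval 0).im < 0 := by
  rw [(IsAlgClosed.splits q).eval_derivative_div_eval_of_ne_zero (h 0 le_rfl)]
  by_cases h0 : q.roots = 0
  · simp [h0]
  · right
    rw [← Complex.coe_imAddGroupHom, map_multiset_sum, Multiset.map_map]
    refine lt_of_lt_of_eq (Multiset.sum_lt_sum_of_nonempty (g := fun _ => (0 : ℝ)) h0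
      fun w hw => ?_) (by simp)
    have hw0 := h.im_neg_of_mem_roots hw
    have hne : w ≠ 0 := by
      rintro rfl
      simp at hw0
    have : 0 < Complex.normSq w := Complex.normSq_pos.mpr hne
    simpa [Complex.inv_im] using div_pos (neg_pos.mpr hw0) this

lemma norm_eval_le (h : RootsInLowerHalfPlane q) {a b : ℂ} (hre : a.re = b.re) (ha : 0 ≤ a.im)
    (hab : a.im ≤ b.im) : ‖q.eval a‖ ≤ ‖q.eval b‖ := by
  have norm_eq : ∀ x : ℂ,
      ‖q.eval x‖ = ‖q.leadingCoeff‖ * (q.roots.map fun w => ‖x - w‖).prod := fun x => by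
    rw [(IsAlgClosed.splits q).eval_eq_prod_roots x, norm_mul]
    congr 1
    exact (map_multiset_prod (normHom : ℂ →*₀ ℝ) _).trans (by rw [Multiset.map_map]; rfl)
  rw [norm_eq, norm_eq]
  refine mul_le_mul_of_nonneg_left ?_ (norm_nonneg _)
  refine Multiset.prod_map_le_prod_map₀ _ _ (fun w _ => norm_nonneg _) fun w hw => ?_
  have hw0 := h.im_neg_of_mem_roots hw
  rw [Complex.norm_def, Complex.norm_def]
  refine Real.sqrt_le_sqrt ?_
  simp only [Complex.normSq_apply, Complex.sub_re, Complex.sub_im, hre]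
  nlinarith

end RootsInLowerHalfPlane

end Polynomial

namespace MvPolynomial

variable {σ : Type*}

lemma pderiv_comm (i j : σ) (p : MvPolynomial σ ℝ) :
    pderiv i (pderiv j p) = pderiv j (pderiv i p) := by
  classical
  have : ⁅pderiv (R := ℝ) i, pderiv (R := ℝ) j⁆ = 0 := by
    refine derivation_ext fun k => ?_
    rw [Derivation.commutator_apply, pderiv_X, pderiv_X]
    simp only [Pi.single_apply]
    split_ifs <;> simp
  have happ := congrArg (fun D => D p) this
  simpa [Derivation.commutator_apply, sub_eq_zero] using happ

lemma single_apply_nonneg [DecidableEq σ] (i : σ) {a : ℝ} (ha : 0 ≤ a) (j : σ) :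
    0 ≤ (Pi.single i a : σ → ℝ) j :=
  (Pi.single_nonneg.mpr ha : 0 ≤ (Pi.single i a : σ → ℝ)) j

section LineRestrict

variable {K : Type*} [CommRing K] [Algebra ℝ K]

/-- The restriction of `p` to the line through `x` in direction `v`. -/
noncomputable def lineRestrict (x v : σ → K) : MvPolynomial σ ℝ →ₐ[ℝ] Polynomial K :=
  aeval fun j => Polynomial.C (x j) + Polynomial.C (v j) * Polynomial.X

lemma aeval_lineRestrict {L : Type*} [CommRing L] [Algebra ℝ L] [Algebra K L] [IsScalarTower ℝ K L]
    (x v : σ → K) (s : L) (p : MvPolynomial σ ℝ) :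
    Polynomial.aeval s (lineRestrict x v p) =
      aeval (fun j => algebraMap K L (x j) + s * algebraMap K L (v j)) p := by
  induction p using MvPolynomial.induction_on with
  | C a => simp [lineRestrict, IsScalarTower.algebraMap_apply ℝ K L, Polynomial.algebraMap_apply]
  | add p q hp hq => simp [hp, hq]
  | mul_X p i hp =>
    rw [map_mul, map_mul, hp, map_mul]
    simp [lineRestrict, mul_comm s]

lemma eval_lineRestrict (x v : σ → K) (s : K) (p : MvPolynomial σ ℝ) :
    (lineRestrict x v p).eval s = aeval (fun j => x j + s * v j) p := by
  rw [← Polynomial.coe_aeval_eq_eval, aeval_lineRestrict]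
  rfl

lemma derivative_lineRestrict_single [DecidableEq σ] (x : σ → K) (i : σ) (p : MvPolynomial σ ℝ) :
    (lineRestrict x (Pi.single i 1) p).derivative =
      lineRestrict x (Pi.single i 1) (pderiv i p) := by
  induction p using MvPolynomial.induction_on with
  | C a => simp [lineRestrict, Polynomial.algebraMap_apply]
  | add p q hp hq => simp [hp, hq]
  | mul_X p k hp =>
    rw [map_mul, Polynomial.derivative_mul, hp, pderiv_mul, map_add, map_mul, map_mul, pderiv_X]
    congr 2
    by_cases hk : k = i
    · subst hk
      simp [lineRestrict]
    · simp [lineRestrict, Pi.single_apply, hk]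

end LineRestrict

lemma continuous_aeval_complex [Finite σ] (p : MvPolynomial σ ℝ) :
    Continuous fun ζ : σ → ℂ => aeval ζ p := by
  simp_rw [aeval_def, ← eval_map]
  exact continuous_eval _

/-- Real stability: no zeros in the product of open upper half planes. -/
def IsRealStable (p : MvPolynomial σ ℝ) : Prop :=
  ∀ ζ : σ → ℂ, (∀ i, 0 < (ζ i).im) → aeval ζ p ≠ 0

/-- The point `z` is above the roots of `p`. -/
def IsAboveRoots (p : MvPolynomial σ ℝ) (z : σ → ℝ) : Prop :=
  ∀ t : σ → ℝ, (∀ j, 0 ≤ t j) → 0 < eval (z + t) p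

lemma IsAboveRoots.eval_pos {p : MvPolynomial σ ℝ} {z : σ → ℝ} (h : IsAboveRoots p z) :
    0 < eval z p := by
  simpa using h 0 fun _ => le_rfl

lemma IsAboveRoots.add {p : MvPolynomial σ ℝ} {z t : σ → ℝ} (h : IsAboveRoots p z)
    (ht : ∀ j, 0 ≤ t j) : IsAboveRoots p (z + t) := fun u hu => by
  rw [add_assoc]
  exact h _ fun j => add_nonneg (ht j) (hu j)

lemma eval_lineRestrict_real (x v : σ → ℝ) (s : ℝ) (p : MvPolynomial σ ℝ) :
    (lineRestrict x v p).eval s = eval (x + s • v) p := by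
  rw [eval_lineRestrict, aeval_eq_eval]
  rfl

lemma IsAboveRoots.lineRestrict_pos {p : MvPolynomial σ ℝ} {z v : σ → ℝ} (h : IsAboveRoots p z)
    (hv : ∀ j, 0 ≤ v j) (s : ℝ) (hs : 0 ≤ s) : 0 < (lineRestrict z v p).eval s := by
  rw [eval_lineRestrict_real]
  exact h _ fun j => mul_nonneg hs (hv j)

lemma IsAboveRoots.lineRestrict_ne_zero {p : MvPolynomial σ ℝ} {z : σ → ℝ}
    (habove : IsAboveRoots p z) (v : σ → ℝ) : lineRestrict z v p ≠ 0 := by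
  intro h0
  have := habove.eval_pos
  have h0' := congrArg (Polynomial.eval 0) h0
  rw [eval_lineRestrict_real] at h0'
  simp only [zero_smul, add_zero, Polynomial.eval_zero] at h0'
  exact this.ne' h0'

namespace IsRealStable

variable {p : MvPolynomial σ ℝ}

section DecidableEq

variable [DecidableEq σ]

lemma rootsInLowerHalfPlane (h : IsRealStable p) {ζ : σ → ℂ} (hζ : ∀ i, 0 < (ζ i).im) (i : σ) :
    (lineRestrict ζ (Pi.single i 1) p).RootsInLowerHalfPlane := by
  intro w hw
  rw [eval_lineRestrict]
  refine h _ fun j => ?_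
  have hj := hζ j
  by_cases hij : j = i
  · subst hij
    simp
    linarith
  · simpa [hij] using hj

lemma logDeriv_eq_zero_or_im_neg (h : IsRealStable p) {ζ : σ → ℂ} (hζ : ∀ i, 0 < (ζ i).im)
    (i : σ) : aeval ζ (pderiv i p) / aeval ζ p = 0 ∨
      (aeval ζ (pderiv i p) / aeval ζ p).im < 0 := by
  have key := (h.rootsInLowerHalfPlane hζ i).logDeriv_eq_zero_or_im_neg
  rw [derivative_lineRestrict_single, eval_lineRestrict, eval_lineRestrict] at key
  simpa using key

end DecidableEq

lemma sub_pderiv (h : IsRealStable p) (i : σ) : IsRealStable (p - pderiv i p) := by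
  classical
  intro ζ hζ h0
  rw [map_sub, sub_eq_zero] at h0
  have key := h.logDeriv_eq_zero_or_im_neg hζ i
  rw [← h0, div_self (h ζ hζ)] at key
  simp at key

lemma mapsToLowerHalfPlane [Finite σ] (h : IsRealStable p) (x : σ → ℝ) {v : σ → ℝ}
    (hv : ∀ j, 0 ≤ v j) (i : σ) :
    (lineRestrict x v (pderiv i p)).MapsToLowerHalfPlane (lineRestrict x v p) := by
  classical
  intro s hs
  let ζ : ℝ → σ → ℂ := fun ε j => x j + s * v j + ε * Complex.I
  have hζ : Continuous ζ := by fun_prop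
  have hcont : Continuous fun ε : ℝ =>
      (aeval (ζ ε) (pderiv i p) * conj (aeval (ζ ε) p)).im := by
    have h₁ := (continuous_aeval_complex p).comp hζ
    have h₂ := (continuous_aeval_complex (pderiv i p)).comp hζ
    simp only [Function.comp_def] at h₁ h₂
    fun_prop
  have key := nonpos_at_zero_of_continuous hcont fun ε hε => by
    have hζ0 : ∀ j, 0 < (ζ ε j).im := fun j => by
      have := mul_nonneg hs.le (hv j)
      simp [ζ]
      linarith
    have hp := h (ζ ε) hζ0
    have him : (aeval (ζ ε) (pderiv i p) / aeval (ζ ε) p).im ≤ 0 := by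
      rcases h.logDeriv_eq_zero_or_im_neg hζ0 i with h0 | h0
      · simp [h0]
      · exact h0.le
    have hmul : aeval (ζ ε) (pderiv i p) * conj (aeval (ζ ε) p) =
        aeval (ζ ε) (pderiv i p) / aeval (ζ ε) p * (Complex.normSq (aeval (ζ ε) p) : ℂ) := by
      rw [← Complex.mul_conj]
      field_simp
    rw [hmul, Complex.im_mul_ofReal]
    exact mul_nonpos_of_nonpos_of_nonneg him (Complex.normSq_nonneg _)
  rw [aeval_lineRestrict, aeval_lineRestrict]
  simpa [ζ] using key

variable [Finite σ] {z : σ → ℝ}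

lemma logDeriv_add_le (h : IsRealStable p) (habove : IsAboveRoots p z) {t : σ → ℝ}
    (ht : ∀ j, 0 ≤ t j) (i : σ) :
    eval (z + t) (pderiv i p) / eval (z + t) p ≤ eval z (pderiv i p) / eval z p := by
  have := (h.mapsToLowerHalfPlane z ht i).div_antitoneOn (habove.lineRestrict_pos ht)
    (Set.mem_Ici.mpr le_rfl) (Set.mem_Ici.mpr zero_le_one) zero_le_one
  simpa [eval_lineRestrict_real] using this

lemma isAboveRoots_sub_pderiv (h : IsRealStable p) (habove : IsAboveRoots p z) {i : σ}
    (hi : eval z (pderiv i p) / eval z p < 1) : IsAboveRoots (p - pderiv i p) z := by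
  intro t ht
  have hpos := habove t ht
  have hlt := (h.logDeriv_add_le habove ht i).trans_lt hi
  rw [div_lt_one hpos] at hlt
  rw [map_sub]
  linarith

variable [DecidableEq σ]

lemma aeval_lineRestrict_ne_zero (h : IsRealStable p) (x : σ → ℝ) (i : σ)
    (hne : lineRestrict x (Pi.single i 1) p ≠ 0) {s : ℂ} (hs : 0 < s.im) :
    Polynomial.aeval s (lineRestrict x (Pi.single i 1) p) ≠ 0 := by
  intro hs0
  let ζ : ℝ → ℂ → σ → ℂ := fun ε w j => x j + ε * Complex.I + w * (Pi.single i 1 : σ → ℂ) j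
  have aeval_eq : ∀ w : ℂ, Polynomial.aeval w (lineRestrict x (Pi.single i 1) p) =
      aeval (ζ 0 w) p := by
    intro w
    rw [aeval_lineRestrict]
    congr 2
    funext j
    by_cases hj : j = i
    · subst hj
      simp [ζ]
    · simp [ζ, hj]
  have hzero : ∀ y ∈ Set.Icc 0 s.im, aeval (ζ 0 ⟨s.re, y⟩) p = 0 := by
    intro y hy
    have hcont : ∀ w, Continuous fun ε : ℝ => ‖aeval (ζ ε w) p‖ := fun w =>
      ((continuous_aeval_complex p).comp (by fun_prop : Continuous fun ε => ζ ε w)).norm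
    have key := nonpos_at_zero_of_continuous ((hcont ⟨s.re, y⟩).sub (hcont s)) fun ε hε => by
      have := (h.rootsInLowerHalfPlane (ζ := fun j => x j + ε * Complex.I)
        (by simpa using fun _ => hε) i).norm_eval_le (a := ⟨s.re, y⟩) (b := s) rfl hy.1 hy.2
      rw [eval_lineRestrict, eval_lineRestrict] at this
      exact sub_nonpos.mpr this
    rw [Pi.sub_apply, ← aeval_eq s, hs0, norm_zero, sub_zero] at key
    exact norm_le_zero_iff.mp key
  have hmap : (lineRestrict x (Pi.single i 1) p).map (algebraMap ℝ ℂ) ≠ 0 :=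
    (Polynomial.map_ne_zero_iff (algebraMap ℝ ℂ).injective).mpr hne
  refine hmap (Polynomial.eq_zero_of_infinite_isRoot _ ?_)
  refine ((Set.Icc_infinite hs).image (f := fun y : ℝ => (⟨s.re, y⟩ : ℂ)) ?_).mono ?_
  · intro y _ y' _ hyy
    simpa using hyy
  · rintro _ ⟨y, hy, rfl⟩
    rw [Set.mem_ofPred_eq, Polynomial.IsRoot.def, Polynomial.eval_map_algebraMap, aeval_eq]
    exact hzero y hy

lemma lineRestrict_splits (h : IsRealStable p) (x : σ → ℝ) (i : σ)
    (hne : lineRestrict x (Pi.single i 1) p ≠ 0) :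
    (lineRestrict x (Pi.single i 1) p).Splits := by
  refine Polynomial.Splits.of_splits_map (algebraMap ℝ ℂ) (IsAlgClosed.splits _) fun a ha => ?_
  have ha0 : Polynomial.aeval a (lineRestrict x (Pi.single i 1) p) = 0 := by
    rw [← Polynomial.eval_map_algebraMap]
    exact Polynomial.isRoot_of_mem_roots ha
  have him : a.im = 0 := by
    refine le_antisymm ?_ ?_
    · by_contra! hpos
      exact h.aeval_lineRestrict_ne_zero x i hne hpos ha0
    · by_contra! hneg
      refine h.aeval_lineRestrict_ne_zero x i hne (s := conj a) (by simpa using hneg) ?_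
      rw [Polynomial.aeval_conj, ha0, map_zero]
  exact ⟨a.re, Complex.ext (by simp) (by simp [him])⟩

lemma eval_pderiv_nonneg (h : IsRealStable p) (habove : IsAboveRoots p z) (i : σ) :
    0 ≤ eval z (pderiv i p) := by
  have hpos := habove.lineRestrict_pos (v := Pi.single i 1)
    (single_apply_nonneg i zero_le_one)
  have hsum := (h.lineRestrict_splits z i (habove.lineRestrict_ne_zero _)
    ).eval_derivative_div_eval_of_ne_zero (hpos 0 le_rfl).ne'
  have hquot : 0 ≤ (lineRestrict z (Pi.single i 1) p).derivative.eval 0 /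
      (lineRestrict z (Pi.single i 1) p).eval 0 := by
    rw [hsum]
    refine Multiset.sum_nonneg fun y hy => ?_
    obtain ⟨r, hr, rfl⟩ := Multiset.mem_map.mp hy
    have : r < 0 := by
      by_contra! h0
      exact (hpos r h0).ne' (Polynomial.isRoot_of_mem_roots hr)
    refine one_div_nonneg.mpr ?_
    linarith
  have := mul_nonneg hquot (hpos 0 le_rfl).le
  rw [div_mul_cancel₀ _ (hpos 0 le_rfl).ne', derivative_lineRestrict_single,
    eval_lineRestrict_real] at this
  simpa using this

lemma logDeriv_sub_pderiv_le (h : IsRealStable p) (habove : IsAboveRoots p z) {φ : ℝ} (hφ : φ < 1)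
    {j : σ} (hj : eval z (pderiv j p) / eval z p ≤ φ) (i : σ) :
    eval (z + Pi.single j (1 / (1 - φ))) (pderiv i (p - pderiv j p)) /
      eval (z + Pi.single j (1 / (1 - φ))) (p - pderiv j p) ≤ eval z (pderiv i p) / eval z p := by
  set δ := 1 / (1 - φ) with hδ_def
  have hφ0 : 0 < 1 - φ := by linarith
  have hδ : 0 < δ := by positivity
  have hv : ∀ k, 0 ≤ (Pi.single j 1 : σ → ℝ) k := single_apply_nonneg j zero_le_one
  have hsmul : δ • (Pi.single j 1 : σ → ℝ) = Pi.single j δ := by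
    rw [← Pi.single_smul, smul_eq_mul, mul_one]
  have hshift : ∀ k, 0 ≤ (Pi.single j δ : σ → ℝ) k := single_apply_nonneg j hδ.le
  have hmaps := h.mapsToLowerHalfPlane z hv i
  have htangent := hmaps.tangent_le
    (h.lineRestrict_splits z j (habove.lineRestrict_ne_zero _)) (habove.lineRestrict_pos hv)
    (fun s hs => by
      rw [eval_lineRestrict_real]
      exact h.eval_pderiv_nonneg (habove.add fun k => mul_nonneg hs (hv k)) i) hδ
  have hW := hmaps.wronskian_nonpos δ
  rw [derivative_lineRestrict_single, derivative_lineRestrict_single] at htangent hW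
  simp only [eval_lineRestrict_real, hsmul, zero_smul, add_zero] at htangent hW
  have hB : 0 < eval (z + Pi.single j δ) p := habove _ hshift
  have hβ := (h.logDeriv_add_le habove hshift j).trans hj
  rw [map_sub, map_sub, map_sub, pderiv_comm i j]
  refine le_trans ?_ htangent
  set b := eval (z + Pi.single j δ) p
  set b' := eval (z + Pi.single j δ) (pderiv j p)
  set a := eval (z + Pi.single j δ) (pderiv i p)
  set a' := eval (z + Pi.single j δ) (pderiv j (pderiv i p))
  rw [div_le_iff₀ hB] at hβ
  have hden : 0 < b - b' := by nlinarith
  have heq : (a - a') / (b - b') = a / b - (a' * b - a * b') / b / (b - b') := by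
    field_simp
    ring
  rw [heq]
  have hinv : 1 / (b - b') ≤ δ / b := by
    rw [div_le_div_iff₀ hden hB, one_mul, ← div_le_iff₀' hδ, hδ_def, div_div_eq_mul_div, div_one]
    linarith
  have hWb : (a' * b - a * b') / b ≤ 0 := div_nonpos_of_nonpos_of_nonneg hW hB.le
  have := mul_le_mul_of_nonpos_left hinv hWb
  calc _ = a / b - (a' * b - a * b') / b * (1 / (b - b')) := by ring
    _ ≤ a / b - (a' * b - a * b') / b * (δ / b) := by linarith
    _ = _ := by
      field_simp

end IsRealStable

end MvPolynomial

theorem barrier_induction {m : ℕ} (p : MvPolynomial (Fin m) ℝ)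
    (hstable : ∀ ζ : Fin m → ℂ, (∀ i, 0 < (ζ i).im) → MvPolynomial.aeval ζ p ≠ 0)
    (z : Fin m → ℝ)
    (habove : ∀ t : Fin m → ℝ, (∀ j, 0 ≤ t j) → 0 < eval (z + t) p)
    (φ δ : ℝ)
    (hφ : ∀ i, eval z (pderiv i p) / eval z p ≤ φ)
    (hφ1 : φ < 1)
    (hδ : δ = 1 / (1 - φ)) :
    ∀ k ≤ m,
      (∀ t : Fin m → ℝ, (∀ j, 0 ≤ t j) →
        0 < eval (fun j : Fin m => (if (j : ℕ) < k then z j + δ else z j) + t j) (applyOpsR p k)) ∧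
      (∀ i, eval (fun j : Fin m => if (j : ℕ) < k then z j + δ else z j) (pderiv i (applyOpsR p k)) /
              eval (fun j : Fin m => if (j : ℕ) < k then z j + δ else z j) (applyOpsR p k) ≤ φ) := by
  suffices H : ∀ k ≤ m, IsRealStable (applyOpsR p k) ∧
      IsAboveRoots (applyOpsR p k) (fun j : Fin m => if (j : ℕ) < k then z j + δ else z j) ∧
      ∀ i, eval (fun j : Fin m => if (j : ℕ) < k then z j + δ else z j)
          (pderiv i (applyOpsR p k)) /
        eval (fun j : Fin m => if (j : ℕ) < k then z j + δ else z j) (applyOpsR p k) ≤ φ from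
    fun k hk => ⟨(H k hk).2.1, (H k hk).2.2⟩
  intro k
  induction k with
  | zero =>
    intro _
    simpa [applyOpsR] using And.intro (show IsRealStable p from hstable) ⟨habove, hφ⟩
  | succ k ih =>
    intro hk
    have hkm : k < m := hk
    obtain ⟨hs, ha, hb⟩ := ih hkm.le
    have hvec : (fun j : Fin m => if (j : ℕ) < k + 1 then z j + δ else z j) =
        (fun j : Fin m => if (j : ℕ) < k then z j + δ else z j) + Pi.single ⟨k, hkm⟩ δ := by
      funext j
      rcases lt_trichotomy (j : ℕ) k with hj | hj | hj
      · simp [hj, hj.trans (Nat.lt_succ_self k), Fin.ext_iff, hj.ne]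
      · simp [hj, Pi.single_apply, Fin.ext_iff]
      · simp [hj.not_gt, (Nat.succ_le_of_lt hj).not_gt, Fin.ext_iff, hj.ne']
    have hδ0 : 0 ≤ δ := by
      rw [hδ]
      exact one_div_nonneg.mpr (by linarith)
    have hops : applyOpsR p (k + 1) = applyOpsR p k - pderiv ⟨k, hkm⟩ (applyOpsR p k) := by
      simp [applyOpsR, hkm]
    rw [hvec, hops]
    refine ⟨hs.sub_pderiv _, (hs.isAboveRoots_sub_pderiv ha ((hb _).trans_lt hφ1)).add
      (single_apply_nonneg _ hδ0), fun i => ?_⟩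
    rw [hδ] at ha hb ⊢
    exact (hs.logDeriv_sub_pderiv_le ha hφ1 (hb _) i).trans (hb i)
end
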